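/- Let f ∈ K(z) be a rational function of degree d > 1, extended canonically to a continuous self-map of P^1_Berk(K). Let μ be a Radon probability measure on P^1_Berk(K) such that: μ(f^{-1}(A)) = μ(A) for every Borel set A; μ is ergodic with respect to f (every Borel set A with f^{-1}(A) = A satisfies μ(A) ∈ {0,1}); f^{-1}(supp μ) = supp μ; and μ({S}) = 0 for every S ∈ P^1_Berk(K) \ P^1(K). Let W be a connected component of P^1_Berk(K) \ supp μ such that f^p(W) = W for some p ∈ ℕ and f^{-1}(W) ≠ W. Then for every connected component U of ⋃_{n≥0} f^{-n}(W), we have μ(∂U) = 0. -/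

import Mathlib

open scoped Classical

open Polynomial Filter MeasureTheory Topology

variable (K : Type*) [NontriviallyNormedField K] [IsAlgClosed K] [CompleteSpace K]
  [IsUltrametricDist K]

/-- The degree of a rational function: max of degrees of numerator and denominator. -/
noncomputable def rdeg (h : RatFunc K) : ℕ := max h.num.natDegree h.denom.natDegree

/-- Canonical homogeneous coordinates of a point of `P^1(K) = K ∪ {∞}`. -/
noncomputable def homCoord : OnePoint K → K × K :=
  OnePoint.rec (1, 0) (fun a => (a, 1))

/-- The (normalized) chordal metric on `P^1(K)`:
`[z,w] = |z0*w1 - z1*w0| / (max(|z0|,|z1|) * max(|w0|,|w1|))`. -/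
noncomputable def chordal (x y : OnePoint K) : ℝ :=
  ‖(homCoord K x).1 * (homCoord K y).2 - (homCoord K x).2 * (homCoord K y).1‖ /
    (max ‖(homCoord K x).1‖ ‖(homCoord K x).2‖ * max ‖(homCoord K y).1‖ ‖(homCoord K y).2‖)

/-- The action of a rational function on the projective line `P^1(K) = K ∪ {∞}`. -/
noncomputable def evalP1 (h : RatFunc K) : OnePoint K → OnePoint K :=
  OnePoint.rec
    (if h.denom.natDegree < h.num.natDegree then OnePoint.infty
      else ((h.num.coeff h.denom.natDegree / h.denom.leadingCoeff : K) : OnePoint K))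
    (fun a => if h.denom.eval a = 0 then OnePoint.infty
      else ((h.num.eval a / h.denom.eval a : K) : OnePoint K))

/-- Composition of rational functions. -/
noncomputable def rcomp (f g : RatFunc K) : RatFunc K :=
  RatFunc.eval (algebraMap K (RatFunc K)) g f

/-- Iterates of a rational function, as rational functions. -/
noncomputable def riter (f : RatFunc K) : ℕ → RatFunc K
  | 0 => RatFunc.X
  | n + 1 => rcomp K f (riter f n)

/-- The Berkovich affine line `A^1(K)`: multiplicative seminorms on `K[z]`
whose restriction to `K` is the absolute value of `K`. -/
structure BerkA1 where
  /-- the seminorm, as a function on polynomials -/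
  toFun : Polynomial K → ℝ
  nonneg' : ∀ p, 0 ≤ toFun p
  map_mul' : ∀ p q, toFun (p * q) = toFun p * toFun q
  add_le' : ∀ p q, toFun (p + q) ≤ toFun p + toFun q
  restricts' : ∀ c : K, toFun (Polynomial.C c) = ‖c‖

/-- The topology of pointwise convergence on the Berkovich affine line. -/
instance : TopologicalSpace (BerkA1 K) :=
  TopologicalSpace.induced BerkA1.toFun Pi.topologicalSpace

/-- The Berkovich projective line `P^1_Berk(K)`, the one-point compactification of the
Berkovich affine line. -/
abbrev BerkP1 := OnePoint (BerkA1 K)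

/-- The evaluation seminorm `p ↦ ‖p(a)‖` attached to a classical point `a ∈ K`. -/
noncomputable def evalSeminorm (a : K) : BerkA1 K where
  toFun p := ‖p.eval a‖
  nonneg' p := norm_nonneg _
  map_mul' p q := by simp [norm_mul]
  add_le' p q := by simpa using norm_add_le (p.eval a) (q.eval a)
  restricts' c := by simp

/-- The canonical embedding of the classical projective line `P^1(K) = K ∪ {∞}`
into the Berkovich projective line. -/
noncomputable def iota : OnePoint K → BerkP1 K :=
  OnePoint.map (evalSeminorm K)

noncomputable instance : MeasurableSpace (BerkP1 K) := borel _

instance : BorelSpace (BerkP1 K) := ⟨rfl⟩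

/-- The support of a measure: points all of whose open neighborhoods have positive measure. -/
def msupport (μ : Measure (BerkP1 K)) : Set (BerkP1 K) :=
  {x | ∀ U : Set (BerkP1 K), IsOpen U → x ∈ U → 0 < μ U}

/-- Weak convergence of a sequence of measures on the Berkovich projective line:
integrals of every continuous real-valued function converge. -/
def WeakTendsto (μs : ℕ → Measure (BerkP1 K)) (μ : Measure (BerkP1 K)) : Prop :=
  ∀ φ : C(BerkP1 K, ℝ),
    Tendsto (fun n => ∫ x, φ x ∂(μs n)) atTop (𝓝 (∫ x, φ x ∂μ))


section BerkGeometry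

variable {K}

set_option linter.unusedSectionVars false
set_option linter.unusedVariables false

/-! ### Basic facts on points of the affine Berkovich line -/

theorem bk_ext {x y : BerkA1 K} (h : ∀ p, x.toFun p = y.toFun p) : x = y := by
  cases x; cases y
  congr
  funext p
  exact h p

theorem bk_zero (x : BerkA1 K) : x.toFun 0 = 0 := by
  have := x.restricts' 0
  simpa using this

theorem bk_one (x : BerkA1 K) : x.toFun 1 = 1 := by
  have := x.restricts' 1
  simpa using this

theorem bk_neg (x : BerkA1 K) (p : K[X]) : x.toFun (-p) = x.toFun p := by
  have h1 := x.map_mul' (C (-1)) p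
  rw [x.restricts'] at h1
  simpa using h1

theorem bk_pow (x : BerkA1 K) (p : K[X]) (n : ℕ) : x.toFun (p ^ n) = x.toFun p ^ n := by
  induction n with
  | zero => simp [bk_one]
  | succ n ih => rw [pow_succ, x.map_mul', ih, pow_succ]

theorem bk_sum_le (x : BerkA1 K) {ι : Type*} (s : Finset ι) (g : ι → K[X]) :
    x.toFun (∑ i ∈ s, g i) ≤ ∑ i ∈ s, x.toFun (g i) := by
  induction s using Finset.induction_on with
  | empty => simp [bk_zero]
  | insert a s ha ih =>
    rw [Finset.sum_insert ha, Finset.sum_insert ha]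
    exact (x.add_le' _ _).trans (by linarith)

theorem bk_multiset_prod (x : BerkA1 K) (s : Multiset K[X]) :
    x.toFun s.prod = (s.map x.toFun).prod := by
  induction s using Multiset.induction_on with
  | empty => simp [bk_one]
  | cons a s ih => rw [Multiset.prod_cons, x.map_mul', ih, Multiset.map_cons, Multiset.prod_cons]

theorem bk_le_of_pow_le {a b : ℝ} (ha : 0 ≤ a) (hb : 0 ≤ b)
    (h : ∀ n : ℕ, a ^ n ≤ (n + 1) * b ^ n) : a ≤ b := by
  by_contra hab
  push Not at hab
  rcases hb.eq_or_lt with rfl | hb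
  · have := h 1
    simp at this
    linarith
  · have hr : 1 < a / b := by rwa [one_lt_div hb]
    have h1 := tendsto_pow_const_div_const_pow_of_one_lt 1 hr
    have h0 := tendsto_pow_const_div_const_pow_of_one_lt 0 hr
    have h2 := h1.add h0
    rw [add_zero] at h2
    have h3 : ∀ n : ℕ, (1 : ℝ) ≤ (n : ℝ) ^ 1 / (a / b) ^ n + (n : ℝ) ^ 0 / (a / b) ^ n := by
      intro n
      rw [← add_div, le_div_iff₀ (by positivity), div_pow, one_mul, div_le_iff₀ (by positivity)]
      simpa using h n
    have := ge_of_tendsto' h2 h3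
    linarith

theorem bk_ultra (x : BerkA1 K) (p q : K[X]) :
    x.toFun (p + q) ≤ max (x.toFun p) (x.toFun q) := by
  refine bk_le_of_pow_le (x.nonneg' _) (le_max_of_le_left (x.nonneg' _)) fun n => ?_
  rw [← bk_pow, add_pow]
  refine (bk_sum_le x _ _).trans ?_
  have : ∀ m ∈ Finset.range (n + 1), x.toFun (p ^ m * q ^ (n - m) * (n.choose m : K[X])) ≤
      max (x.toFun p) (x.toFun q) ^ n := by
    intro m hm
    have hm' : m ≤ n := by simpa [Nat.lt_succ_iff] using hm
    rw [x.map_mul', x.map_mul', bk_pow, bk_pow]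
    have h1 : x.toFun (n.choose m : K[X]) ≤ 1 := by
      have := x.restricts' (n.choose m : K)
      rw [map_natCast] at this
      rw [this]
      exact IsUltrametricDist.norm_natCast_le_one K _
    calc _ ≤ max (x.toFun p) (x.toFun q) ^ m * max (x.toFun p) (x.toFun q) ^ (n - m) * 1 := by
          have := x.nonneg' p
          have := x.nonneg' q
          gcongr
          · exact x.nonneg' _
          · exact le_max_left _ _
          · exact le_max_right _ _
      _ = _ := by rw [mul_one, ← pow_add, Nat.add_sub_cancel' hm']
  refine (Finset.sum_le_sum this).trans ?_
  simp

/-- The value `|z - c|` at a point of the affine line. -/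
noncomputable def bkn (x : BerkA1 K) (c : K) : ℝ := x.toFun (X - C c)

theorem bkn_nonneg (x : BerkA1 K) (c : K) : 0 ≤ bkn x c := x.nonneg' _

theorem bkn_le (x : BerkA1 K) (c c' : K) : bkn x c ≤ max (bkn x c') ‖c - c'‖ := by
  have : (X - C c : K[X]) = (X - C c') + C (c' - c) := by simp
  rw [bkn, this]
  refine (bk_ultra x _ _).trans ?_
  rw [x.restricts', norm_sub_rev]
  rfl

theorem bkn_sub_le (x : BerkA1 K) (c c' : K) : ‖c - c'‖ ≤ max (bkn x c) (bkn x c') := by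
  have : C (c - c') = (X - C c') + -(X - C c) := by simp
  rw [← x.restricts', this]
  refine (bk_ultra x _ _).trans ?_
  rw [bk_neg, max_comm]
  rfl

/-- Far away, all the values agree. -/
theorem bkn_far (x : BerkA1 K) (c c' : K) (h : ‖c - c'‖ < bkn x c') : bkn x c = bkn x c' := by
  have h1 := bkn_le x c c'
  have h2 := bkn_le x c' c
  rw [norm_sub_rev] at h2
  rw [max_eq_left h.le] at h1
  refine le_antisymm h1 ?_
  rcases le_max_iff.1 h2 with h3 | h3
  · exact h3
  · linarith

theorem bk_toFun_eq (x : BerkA1 K) (p : K[X]) :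
    x.toFun p = ‖p.leadingCoeff‖ * (p.roots.map (bkn x)).prod := by
  have h := (IsAlgClosed.splits p).eq_prod_roots
  conv_lhs => rw [h]
  rw [x.map_mul', x.restricts', bk_multiset_prod, Multiset.map_map]
  rfl

theorem bk_ext_bkn {x y : BerkA1 K} (h : ∀ c, bkn x c = bkn y c) : x = y := by
  apply bk_ext
  intro p
  rw [bk_toFun_eq, bk_toFun_eq]
  have : bkn x = bkn y := funext h
  rw [this]

theorem bkn_eq_zero (x : BerkA1 K) (c : K) (h : bkn x c = 0) : x = evalSeminorm K c := by
  apply bk_ext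
  intro p
  obtain ⟨q, hq⟩ : (X - C c) ∣ p - C (p.eval c) := by
    rw [dvd_iff_isRoot]; simp
  have h0 : x.toFun (p - C (p.eval c)) = 0 := by
    rw [hq, x.map_mul']
    have : x.toFun (X - C c) = 0 := h
    rw [this, zero_mul]
  have h1 := x.add_le' (p - C (p.eval c)) (C (p.eval c))
  have h2 := x.add_le' (-(p - C (p.eval c))) p
  rw [bk_neg, h0] at h2
  rw [h0, x.restricts'] at h1
  have e : -(p - C (eval c p)) + p = C (eval c p) := by ring
  rw [e, x.restricts'] at h2
  simp only [sub_add_cancel, zero_add] at h1 h2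
  exact le_antisymm h1 h2

theorem bk_toFun_eq_zero (x : BerkA1 K) (p : K[X]) (hp : p ≠ 0) (h : x.toFun p = 0) :
    ∃ c ∈ p.roots, x = evalSeminorm K c := by
  rw [bk_toFun_eq] at h
  rcases mul_eq_zero.1 h with h | h
  · simp [hp] at h
  · rw [Multiset.prod_eq_zero_iff, Multiset.mem_map] at h
    obtain ⟨c, hc, h⟩ := h
    exact ⟨c, hc, bkn_eq_zero x c h⟩

theorem bkn_eval (a c : K) : bkn (evalSeminorm K a) c = ‖a - c‖ := by
  simp [bkn, evalSeminorm]

theorem bk_isEmbedding : IsEmbedding (BerkA1.toFun : BerkA1 K → (K[X] → ℝ)) :=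
  ⟨⟨rfl⟩, fun x y h => bk_ext (fun p => congrFun h p)⟩

theorem bk_continuous_toFun (p : K[X]) : Continuous (fun x : BerkA1 K => x.toFun p) :=
  (continuous_apply p).comp bk_isEmbedding.continuous

theorem bk_bound (x : BerkA1 K) (R : ℝ) (hx : x.toFun X ≤ R) (p : K[X]) :
    x.toFun p ≤ ∑ i ∈ p.support, ‖p.coeff i‖ * R ^ i := by
  conv_lhs => rw [p.as_sum_support_C_mul_X_pow]
  refine (bk_sum_le x _ _).trans (Finset.sum_le_sum fun i _ => ?_)
  rw [x.map_mul', x.restricts', bk_pow]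
  have := x.nonneg' X
  gcongr

theorem bk_isCompact (R : ℝ) : IsCompact {x : BerkA1 K | x.toFun X ≤ R} := by
  rw [bk_isEmbedding.isCompact_iff]
  set S : Set (K[X] → ℝ) := {g | (∀ p, 0 ≤ g p) ∧ (∀ p q, g (p * q) = g p * g q) ∧
    (∀ p q, g (p + q) ≤ g p + g q) ∧ (∀ c : K, g (C c) = ‖c‖) ∧ g X ≤ R} with hS
  have hSc : IsClosed S := by
    simp only [hS, Set.ofPred_and, Set.ofPred_forall]
    refine IsClosed.inter ?_ (IsClosed.inter ?_ (IsClosed.inter ?_ (IsClosed.inter ?_ ?_)))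
    · exact isClosed_iInter fun p => isClosed_le continuous_const (continuous_apply p)
    · exact isClosed_iInter fun p => isClosed_iInter fun q => isClosed_eq (continuous_apply _)
        ((continuous_apply p).mul (continuous_apply q))
    · exact isClosed_iInter fun p => isClosed_iInter fun q => isClosed_le (continuous_apply _)
        ((continuous_apply p).add (continuous_apply q))
    · exact isClosed_iInter fun p => isClosed_eq (continuous_apply _) continuous_const
    · exact isClosed_le (continuous_apply _) continuous_const
  have himg : BerkA1.toFun '' {x : BerkA1 K | x.toFun X ≤ R} = S := by
    ext g
    constructor
    · rintro ⟨x, hx, rfl⟩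
      exact ⟨x.nonneg', x.map_mul', x.add_le', x.restricts', hx⟩
    · rintro ⟨h1, h2, h3, h4, h5⟩
      exact ⟨⟨g, h1, h2, h3, h4⟩, h5, rfl⟩
  rw [himg]
  have hK : IsCompact (Set.pi Set.univ (fun p : K[X] => Set.Icc (0 : ℝ)
      (∑ i ∈ p.support, ‖p.coeff i‖ * R ^ i))) := isCompact_univ_pi fun _ => isCompact_Icc
  refine hK.of_isClosed_subset hSc ?_
  rintro g ⟨h1, h2, h3, h4, h5⟩ p -
  exact ⟨h1 p, bk_bound ⟨g, h1, h2, h3, h4⟩ R h5 p⟩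

/-- Normalized homogeneous value of `z - c` at a point of the projective line. -/
noncomputable def bkN (x : BerkP1 K) (c : K) : ℝ :=
  OnePoint.elim x 1 (fun y : BerkA1 K => bkn y c / max 1 (bkn y 0))

theorem bkN_infty (c : K) : bkN (OnePoint.infty : BerkP1 K) c = 1 := rfl

theorem bkN_coe (y : BerkA1 K) (c : K) : bkN (y : BerkP1 K) c = bkn y c / max 1 (bkn y 0) := rfl

theorem bkN_nonneg (x : BerkP1 K) (c : K) : 0 ≤ bkN x c := by
  induction x using OnePoint.rec with
  | infty => simp [bkN_infty]
  | coe y => rw [bkN_coe]; have := bkn_nonneg y c; positivity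

theorem bkN_continuous (c : K) : Continuous (fun x : BerkP1 K => bkN x c) := by
  rw [OnePoint.continuous_iff]
  constructor
  · refine Tendsto.congr' ?_ tendsto_const_nhds
    have hc : IsClosed {x : BerkA1 K | x.toFun X ≤ max 1 ‖c‖} :=
      isClosed_le (bk_continuous_toFun X) continuous_const
    have hk := (bk_isCompact (K := K) (max 1 ‖c‖)).compl_mem_coclosedCompact_of_isClosed hc
    filter_upwards [hk] with y hy
    have h0 : bkn y 0 = y.toFun X := by simp [bkn]
    simp only [Set.mem_compl_iff, Set.mem_setOf_eq, not_le, ← h0, max_lt_iff] at hy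
    rw [bkN_infty, bkN_coe, bkn_far y c 0 (by simpa using hy.2), max_eq_right hy.1.le, div_self]
    linarith
  · simp only [bkN_coe]
    refine (bk_continuous_toFun _).div (continuous_const.max (bk_continuous_toFun _)) ?_
    intro x
    have : (1 : ℝ) ≤ max 1 (bkn x 0) := le_max_left _ _
    intro h
    change max 1 (bkn x 0) = 0 at h
    linarith

theorem bkN_iota (a c : K) : bkN (iota K (a : OnePoint K)) c = ‖a - c‖ / max 1 ‖a‖ := by
  have : iota K (a : OnePoint K) = ((evalSeminorm K a : BerkA1 K) : BerkP1 K) := rfl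
  rw [this, bkN_coe, bkn_eval, bkn_eval, sub_zero]

end BerkGeometry


section BerkGeometry2

variable {K}

set_option linter.unusedSectionVars false
set_option linter.unusedVariables false

/-- The classical point attached to an element of `K`. -/
noncomputable def cl (a : K) : BerkP1 K := iota K (a : OnePoint K)

theorem bkN_cl (a c : K) : bkN (cl a) c = ‖a - c‖ / max 1 ‖a‖ := bkN_iota a c

theorem cl_eq (a : K) : cl a = ((evalSeminorm K a : BerkA1 K) : BerkP1 K) := rfl

theorem max_one_pos (r : ℝ) : 0 < max 1 r := lt_of_lt_of_le one_pos (le_max_left _ _)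

theorem bkN_pl (x : BerkP1 K) (a b c : K) :
    ‖b - c‖ * bkN x a ≤ max (‖a - c‖ * bkN x b) (‖a - b‖ * bkN x c) := by
  induction x using OnePoint.rec with
  | infty =>
    simp only [bkN_infty, mul_one]
    have := IsUltrametricDist.norm_add_le_max (a - c) (b - a)
    rw [norm_sub_rev b a] at this
    refine le_trans (le_of_eq ?_) this
    congr 1; ring
  | coe y =>
    simp only [bkN_coe]
    have hm := max_one_pos (bkn y 0)
    rw [mul_div_assoc', mul_div_assoc', mul_div_assoc', max_div_div_right hm.le]
    apply div_le_div_of_nonneg_right _ hm.le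
    have h : C (b - c) * (X - C a) = C (a - c) * (X - C b) + C (b - a) * (X - C c) := by
      simp only [map_sub]; ring
    have h1 := bk_ultra y (C (a - c) * (X - C b)) (C (b - a) * (X - C c))
    rw [← h] at h1
    simp only [y.map_mul', y.restricts'] at h1
    rwa [norm_sub_rev b a] at h1

theorem bkN_eq_zero (x : BerkP1 K) (a : K) (h : bkN x a = 0) : x = cl a := by
  induction x using OnePoint.rec with
  | infty => simp [bkN_infty] at h
  | coe y =>
    rw [bkN_coe, div_eq_zero_iff] at h
    rcases h with h | h
    · rw [bkn_eq_zero y a h]; rfl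
    · have := max_one_pos (bkn y 0); linarith

theorem bkN_cl_pos {a c : K} (h : a ≠ c) : 0 < bkN (cl a) c := by
  rw [bkN_cl]
  have := max_one_pos ‖a‖
  have : 0 < ‖a - c‖ := norm_pos_iff.2 (sub_ne_zero.2 h)
  positivity

theorem bkN_cl_self (a : K) : bkN (cl a) a = 0 := by
  rw [bkN_cl]; simp

theorem cl_injective : Function.Injective (cl : K → BerkP1 K) := by
  intro a b h
  by_contra hab
  have h1 := bkN_cl_pos hab
  rw [h, bkN_cl_self] at h1
  exact lt_irrefl _ h1

theorem bkN_pos_of_ne {x : BerkP1 K} {a : K} (h : x ≠ cl a) : 0 < bkN x a :=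
  lt_of_le_of_ne (bkN_nonneg x a) (fun h' => h (bkN_eq_zero x a h'.symm))

theorem bkN_pos_or (x : BerkP1 K) {a b : K} (h : a ≠ b) (ha : bkN x a = 0) : 0 < bkN x b := by
  rw [bkN_eq_zero x a ha]
  exact bkN_cl_pos h

theorem exists_norm_gt (r : ℝ) : ∃ c : K, r < ‖c‖ := NormedField.exists_lt_norm K r

theorem bkn_eq_norm (x : BerkA1 K) (c : K) (h : bkn x 0 < ‖c‖) : bkn x c = ‖c‖ := by
  have h1 := bkn_le x c 0
  have h2 := bkn_sub_le x c 0
  rw [sub_zero] at h1 h2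
  rw [max_eq_right h.le] at h1
  refine le_antisymm h1 ?_
  rcases le_max_iff.1 h2 with h3 | h3
  · exact h3
  · linarith

theorem bkN_infty_ne (y : BerkA1 K) (h : ∀ c c' : K, bkN (y : BerkP1 K) c = bkN (y : BerkP1 K) c') :
    False := by
  obtain ⟨c, hc⟩ := exists_norm_gt (K := K) (bkn y 0)
  have h1 := h c 0
  have hm := max_one_pos (bkn y 0)
  rw [bkN_coe, bkN_coe, div_left_inj' hm.ne'] at h1
  rw [bkn_eq_norm y c hc] at h1
  linarith

theorem bkN_sep {x y : BerkP1 K} (h : ∀ c c', bkN x c * bkN y c' = bkN x c' * bkN y c) : x = y := by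
  induction x using OnePoint.rec with
  | infty =>
    induction y using OnePoint.rec with
    | infty => rfl
    | coe y =>
      exfalso
      refine bkN_infty_ne y fun c c' => ?_
      have := h c c'
      simp only [bkN_infty, one_mul] at this
      exact this.symm
  | coe x =>
    induction y using OnePoint.rec with
    | infty =>
      exfalso
      refine bkN_infty_ne x fun c c' => ?_
      have := h c c'
      simpa only [bkN_infty, mul_one] using this
    | coe y =>
      congr 1
      apply bk_ext_bkn
      intro c
      obtain ⟨c', hc'⟩ := exists_norm_gt (K := K) (max (bkn x 0) (bkn y 0))
      rw [max_lt_iff] at hc'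
      have h1 := h c c'
      have hm := max_one_pos (bkn y 0)
      have hm' := max_one_pos (bkn x 0)
      simp only [bkN_coe] at h1
      rw [bkn_eq_norm x c' hc'.1, bkn_eq_norm y c' hc'.2] at h1
      have h0 : 0 < ‖c'‖ := lt_of_le_of_lt (bkn_nonneg x 0) hc'.1
      field_simp at h1
      exact h1

theorem bkN_injective : Function.Injective (bkN : BerkP1 K → K → ℝ) := by
  intro x y h
  apply bkN_sep
  intro c c'
  rw [h]; ring

theorem bkN_continuous' : Continuous (bkN : BerkP1 K → K → ℝ) :=
  continuous_pi bkN_continuous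

instance bkP1_t2 : T2Space (BerkP1 K) := T2Space.of_injective_continuous bkN_injective bkN_continuous'

theorem bkN_isInducing : IsInducing (bkN : BerkP1 K → K → ℝ) :=
  (bkN_continuous'.isClosedEmbedding bkN_injective).isInducing

theorem bk_continuous_iff {Y : Type*} [TopologicalSpace Y] {g : Y → BerkP1 K} :
    Continuous g ↔ ∀ c, Continuous fun y => bkN (g y) c := by
  rw [bkN_isInducing.continuous_iff, continuous_pi_iff]
  rfl

theorem bk_tendsto_iff {Y : Type*} {l : Filter Y} {g : Y → BerkP1 K} {x : BerkP1 K} :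
    Tendsto g l (𝓝 x) ↔ ∀ c, Tendsto (fun y => bkN (g y) c) l (𝓝 (bkN x c)) := by
  rw [bkN_isInducing.tendsto_nhds_iff, tendsto_pi_nhds]
  rfl

/-- The basic sets `{N(x,a) < R N(x,b)}`. -/
def bset (a b : K) (R : ℝ) : Set (BerkP1 K) := {x | bkN x a < R * bkN x b}

theorem mem_bset {a b : K} {R : ℝ} {x : BerkP1 K} : x ∈ bset a b R ↔ bkN x a < R * bkN x b := Iff.rfl

theorem bset_open (a b : K) (R : ℝ) : IsOpen (bset a b R) :=
  isOpen_lt (bkN_continuous a) (continuous_const.mul (bkN_continuous b))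

theorem bk_separate {x y : BerkP1 K} (h : x ≠ y) : ∃ a b : K, ∃ R : ℝ, 0 < R ∧
    bkN x a < R * bkN x b ∧ R * bkN y b < bkN y a := by
  have key : ∀ c c', bkN x c * bkN y c' < bkN x c' * bkN y c → ∃ a b : K, ∃ R : ℝ, 0 < R ∧
    bkN x a < R * bkN x b ∧ R * bkN y b < bkN y a := by
    intro c c' hlt
    have h1 := bkN_nonneg x c
    have h2 := bkN_nonneg y c'
    have h3 : 0 < bkN x c' := by
      refine lt_of_le_of_ne (bkN_nonneg x c') fun h0 => ?_
      rw [← h0, zero_mul] at hlt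
      exact absurd hlt (not_lt.2 (mul_nonneg h1 h2))
    have h4 : 0 < bkN y c := by
      refine lt_of_le_of_ne (bkN_nonneg y c) fun h0 => ?_
      rw [← h0, mul_zero] at hlt
      exact absurd hlt (not_lt.2 (mul_nonneg h1 h2))
    refine ⟨c, c', ?_⟩
    rcases h2.eq_or_lt with h5 | h5
    · refine ⟨bkN x c / bkN x c' + 1, by positivity, ?_, ?_⟩
      · rw [add_mul, div_mul_cancel₀ _ h3.ne']; linarith
      · rw [← h5, mul_zero]; exact h4
    · have : bkN x c / bkN x c' < bkN y c / bkN y c' := by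
        rw [div_lt_div_iff₀ h3 h5]; linarith
      obtain ⟨R, hR1, hR2⟩ := exists_between this
      refine ⟨R, lt_of_le_of_lt (by positivity) hR1, ?_, ?_⟩
      · rwa [div_lt_iff₀ h3] at hR1
      · rwa [lt_div_iff₀ h5] at hR2
  by_contra hcon
  apply h
  apply bkN_sep
  intro c c'
  by_contra hne
  rcases lt_or_gt_of_ne hne with h1 | h1
  · exact hcon (key c c' h1)
  · exact hcon (key c' c h1)

theorem bk_basis {O : Set (BerkP1 K)} (hO : IsOpen O) {x : BerkP1 K} (hx : x ∈ O) :
    ∃ T : Finset (K × K × ℝ), (∀ k ∈ T, 0 < k.2.2) ∧ x ∈ (⋂ k ∈ T, bset k.1 k.2.1 k.2.2) ∧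
      (⋂ k ∈ T, bset k.1 k.2.1 k.2.2) ⊆ O := by
  have hc : IsCompact Oᶜ := hO.isClosed_compl.isCompact
  have hne : ∀ y ∈ Oᶜ, ∃ k : K × K × ℝ, 0 < k.2.2 ∧ bkN x k.1 < k.2.2 * bkN x k.2.1 ∧
      k.2.2 * bkN y k.2.1 < bkN y k.1 := by
    intro y hy
    obtain ⟨a, b, R, h⟩ := bk_separate (x := x) (y := y) (fun h => hy (h ▸ hx))
    exact ⟨(a, b, R), h⟩
  choose! k hk1 hk2 hk3 using hne
  obtain ⟨T, hT1⟩ := hc.elim_nhds_subcover' (fun y hy => {z | (k y).2.2 * bkN z (k y).2.1 < bkN z (k y).1})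
    (fun y hy => (isOpen_lt (continuous_const.mul (bkN_continuous _)) (bkN_continuous _)).mem_nhds
      (hk3 y hy))
  refine ⟨T.image (fun y => k y.1), ?_, ?_, ?_⟩
  · intro q hq
    rw [Finset.mem_image] at hq
    obtain ⟨y, hy, rfl⟩ := hq
    exact hk1 y y.2
  · simp only [Set.mem_iInter]
    intro q hq
    rw [Finset.mem_image] at hq
    obtain ⟨y, hy, rfl⟩ := hq
    exact hk2 y y.2
  · intro z hz
    by_contra hzO
    have := hT1 hzO
    simp only [Set.mem_iUnion] at this
    obtain ⟨y, hy, hyz⟩ := this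
    simp only [Set.mem_iInter] at hz
    have := hz (k y.1) (Finset.mem_image_of_mem _ hy)
    rw [mem_bset] at this
    rw [Set.mem_ofPred_eq] at hyz
    exact lt_asymm hyz this

end BerkGeometry2


section BerkGeometry3

variable {K}

set_option linter.unusedSectionVars false
set_option linter.unusedVariables false

theorem nrm_tri (a b c : K) : ‖a - c‖ ≤ max ‖a - b‖ ‖b - c‖ := by
  have := IsUltrametricDist.norm_add_le_max (a - b) (b - c)
  simpa using this

/-- Gauss points (discs `D(a,r)`). -/
noncomputable def gpt (a : K) (r : ℝ) : BerkA1 K :=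
  if hr : 0 < r then
    { toFun := fun p => gaussNorm (NormedField.toAbsoluteValue K) r (taylor a p)
      nonneg' := fun p => gaussNorm_nonneg _ _ hr.le
      map_mul' := fun p q => by
        rw [taylor_mul]
        exact gaussNorm_mul (IsUltrametricDist.isNonarchimedean_norm) hr _ _
      add_le' := fun p q => by
        rw [map_add]
        refine (isNonarchimedean_gaussNorm (NormedField.toAbsoluteValue K)
          (IsUltrametricDist.isNonarchimedean_norm) hr.le _ _).trans ?_
        exact max_le_add_of_nonneg (gaussNorm_nonneg _ _ hr.le) (gaussNorm_nonneg _ _ hr.le)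
      restricts' := fun c => by
        rw [taylor_C, gaussNorm_C]
        rfl }
  else evalSeminorm K a

theorem bkn_gpt (a c : K) {r : ℝ} (hr : 0 ≤ r) : bkn (gpt a r) c = max r ‖a - c‖ := by
  rcases hr.eq_or_lt with rfl | h
  · simp [gpt, bkn_eval]
  · have e : taylor a (X - C c) = X + C (a - c) := by
      simp [taylor_X, taylor_C]; ring
    have e2 : bkn (gpt a r) c = gaussNorm (NormedField.toAbsoluteValue K) r (X + C (a - c)) := by
      rw [← e]
      simp [gpt, bkn, h]
    have hv : ∀ z : K, NormedField.toAbsoluteValue K z = ‖z‖ := fun z => rfl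
    rw [e2]
    apply le_antisymm
    · refine (isNonarchimedean_gaussNorm (NormedField.toAbsoluteValue K)
          (IsUltrametricDist.isNonarchimedean_norm) hr _ _).trans ?_
      rw [← monomial_one_one_eq_X, gaussNorm_monomial, gaussNorm_C]
      simp [hv]
    · apply max_le
      · have := le_gaussNorm (NormedField.toAbsoluteValue K) (X + C (a - c)) hr 1
        simpa [coeff_X, coeff_C] using this
      · have := le_gaussNorm (NormedField.toAbsoluteValue K) (X + C (a - c)) hr 0
        simpa [coeff_X, hv] using this

/-- The point at parameter `t` on the path from `a` to `b`. -/
noncomputable def etp (a b : K) (t : ℝ) : BerkP1 K :=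
  if t ≤ 1 then ((gpt a (t * ‖a - b‖) : BerkA1 K) : BerkP1 K)
  else ((gpt b (‖a - b‖ / t) : BerkA1 K) : BerkP1 K)

/-- normalizing denominator -/
noncomputable def etaden (a b : K) (t : ℝ) : ℝ := max (max t 1) (max (t * ‖b‖) ‖a‖)

theorem etaden_pos (a b : K) (t : ℝ) : 0 < etaden a b t :=
  lt_of_lt_of_le one_pos ((le_max_right _ _).trans (le_max_left _ _))

theorem max_aux1 {t d u v : ℝ} (ht : 0 ≤ t) (h1 : t ≤ 1) (hv : 0 ≤ v) (hd : d ≤ max u v)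
    (hu : u ≤ max d v) : max (t * d) v = max (t * u) v := by
  have hh : t * v ≤ v := by nlinarith
  apply le_antisymm
  · apply max_le _ (le_max_right _ _)
    calc t * d ≤ t * max u v := by gcongr
      _ = max (t * u) (t * v) := mul_max_of_nonneg _ _ ht
      _ ≤ _ := max_le_max le_rfl hh
  · apply max_le _ (le_max_right _ _)
    calc t * u ≤ t * max d v := by gcongr
      _ = max (t * d) (t * v) := mul_max_of_nonneg _ _ ht
      _ ≤ _ := max_le_max le_rfl hh

theorem gpt_formula (a b c : K) {t : ℝ} (ht : 0 ≤ t) (h : t ≤ 1) :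
    bkn (gpt a (t * ‖a - b‖)) c = max (t * ‖c - b‖) ‖c - a‖ := by
  rw [bkn_gpt _ _ (by positivity), norm_sub_rev a c]
  apply max_aux1 ht h (norm_nonneg _)
  · have := nrm_tri a c b
    rwa [norm_sub_rev a c, max_comm] at this
  · have := nrm_tri c a b
    rwa [max_comm] at this

theorem bkN_eta (a b c : K) {t : ℝ} (ht : 0 ≤ t) :
    bkN (etp a b t) c = max (t * ‖c - b‖) ‖c - a‖ / etaden a b t := by
  unfold etp etaden
  split_ifs with h
  · rw [bkN_coe, gpt_formula a b c ht h, gpt_formula a b 0 ht h]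
    rw [max_eq_right h]
    simp
  · push Not at h
    have ht0 : 0 < t := by linarith
    have h1 : t⁻¹ ≤ 1 := inv_le_one_of_one_le₀ h.le
    have h0 : 0 ≤ t⁻¹ := by positivity
    have e : ‖a - b‖ / t = t⁻¹ * ‖b - a‖ := by rw [norm_sub_rev]; field_simp
    rw [e, bkN_coe, gpt_formula b a c h0 h1, gpt_formula b a 0 h0 h1]
    rw [max_eq_left h.le]
    simp only [zero_sub, norm_neg]
    have hh : ∀ u v : ℝ, max (t⁻¹ * u) v = t⁻¹ * max (t * v) u := by
      intro u v
      rw [mul_max_of_nonneg _ _ h0, max_comm, inv_mul_cancel_left₀ ht0.ne']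
    have h3 : max 1 (max (t⁻¹ * ‖a‖) ‖b‖) = t⁻¹ * max t (max (t * ‖b‖) ‖a‖) := by
      rw [mul_max_of_nonneg _ _ h0, ← hh, inv_mul_cancel₀ ht0.ne']
    rw [hh, h3, mul_div_mul_left _ _ (by positivity)]

theorem eta_continuousOn (a b : K) : Continuous (fun t : Set.Ici (0 : ℝ) => etp a b t) := by
  rw [bk_continuous_iff]
  intro c
  have : (fun t : Set.Ici (0 : ℝ) => bkN (etp a b t) c) =
      fun t : Set.Ici (0 : ℝ) => max ((t : ℝ) * ‖c - b‖) ‖c - a‖ / etaden a b t := by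
    funext t
    exact bkN_eta a b c t.2
  rw [this]
  refine Continuous.div (by fun_prop) (by unfold etaden; fun_prop) ?_
  intro t
  exact (etaden_pos a b t).ne'

/-- `y` lies on the path from `a` to `b`. -/
def Bet (a b : K) (y : BerkP1 K) : Prop :=
  ∀ c, ‖a - b‖ * bkN y c = max (bkN y a * ‖c - b‖) (bkN y b * ‖c - a‖)

theorem Bet.symm {a b : K} {y : BerkP1 K} (h : Bet a b y) : Bet b a y := by
  intro c
  rw [norm_sub_rev, h c, max_comm]

theorem bkN_eta_left (a b : K) {t : ℝ} (ht : 0 ≤ t) :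
    bkN (etp a b t) a = t * ‖a - b‖ / etaden a b t := by
  rw [bkN_eta a b a ht, sub_self, norm_zero, max_eq_left (by positivity)]

theorem bkN_eta_right (a b : K) {t : ℝ} (ht : 0 ≤ t) :
    bkN (etp a b t) b = ‖a - b‖ / etaden a b t := by
  rw [bkN_eta a b b ht, sub_self, norm_zero, mul_zero, max_eq_right (by positivity), norm_sub_rev]

theorem eta_bet (a b : K) {t : ℝ} (ht : 0 ≤ t) : Bet a b (etp a b t) := by
  intro c
  rw [bkN_eta a b c ht, bkN_eta_left a b ht, bkN_eta_right a b ht]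
  have h := etaden_pos a b t
  rw [mul_div_assoc', div_mul_eq_mul_div, div_mul_eq_mul_div, max_div_div_right h.le,
    mul_max_of_nonneg _ _ (norm_nonneg _)]
  congr 2
  ring

theorem eta_ratio (a b : K) {t : ℝ} (ht : 0 ≤ t) :
    bkN (etp a b t) a = t * bkN (etp a b t) b := by
  rw [bkN_eta a b a ht, bkN_eta a b b ht]
  simp only [sub_self, norm_zero, mul_zero]
  rw [max_eq_left (by positivity), max_eq_right (by positivity), norm_sub_rev b a]
  ring

theorem eta_zero (a b : K) : etp a b 0 = cl a := by
  apply bkN_eq_zero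
  rw [eta_ratio a b le_rfl, zero_mul]

theorem bet_unique {a b : K} (hab : a ≠ b) {t : ℝ} {y y' : BerkP1 K} (h : Bet a b y)
    (hr : bkN y a = t * bkN y b) (h' : Bet a b y') (hr' : bkN y' a = t * bkN y' b) : y = y' := by
  apply bkN_sep
  have hd : 0 < ‖a - b‖ := norm_pos_iff.2 (sub_ne_zero.2 hab)
  have key : ∀ y : BerkP1 K, Bet a b y → bkN y a = t * bkN y b →
      ∀ c, ‖a - b‖ * bkN y c = bkN y b * max (t * ‖c - b‖) ‖c - a‖ := by
    intro y h hr c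
    rw [h c, hr, mul_max_of_nonneg _ _ (bkN_nonneg _ _)]
    congr 1
    ring
  intro c c'
  have e1 := key y h hr c
  have e2 := key y h hr c'
  have e3 := key y' h' hr' c
  have e4 := key y' h' hr' c'
  have : ‖a - b‖ * ‖a - b‖ * (bkN y c * bkN y' c') = ‖a - b‖ * ‖a - b‖ * (bkN y c' * bkN y' c) := by
    calc _ = (‖a - b‖ * bkN y c) * (‖a - b‖ * bkN y' c') := by ring
      _ = (‖a - b‖ * bkN y c') * (‖a - b‖ * bkN y' c) := by rw [e1, e2, e3, e4]; ring
      _ = _ := by ring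
  exact mul_left_cancel₀ (by positivity) this

theorem eq_eta {a b : K} (hab : a ≠ b) {t : ℝ} (ht : 0 ≤ t) {y : BerkP1 K} (h : Bet a b y)
    (hr : bkN y a = t * bkN y b) : y = etp a b t :=
  bet_unique hab h hr (eta_bet a b ht) (eta_ratio a b ht)

theorem bkN_eta_pos_right {a b : K} (hab : a ≠ b) {t : ℝ} (ht : 0 ≤ t) : 0 < bkN (etp a b t) b := by
  rw [bkN_eta a b b ht]
  have h := etaden_pos a b t
  have hd : 0 < ‖b - a‖ := norm_pos_iff.2 (sub_ne_zero.2 hab.symm)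
  apply div_pos _ h
  exact lt_of_lt_of_le hd (le_max_right _ _)

theorem eta_swap {a b : K} (hab : a ≠ b) {t : ℝ} (ht : 0 < t) : etp a b t = etp b a t⁻¹ := by
  apply eq_eta hab.symm (by positivity) (eta_bet a b ht.le).symm
  rw [eta_ratio a b ht.le, inv_mul_cancel_left₀ ht.ne']

theorem eta_tendsto_infty {a b : K} (hab : a ≠ b) : Tendsto (etp a b) atTop (𝓝 (cl b)) := by
  have h1 : Tendsto (fun s : ℝ => etp b a s) (𝓝[≥] 0) (𝓝 (etp b a 0)) := by
    have := ((eta_continuousOn b a).tendsto ⟨0, Set.mem_Ici.2 le_rfl⟩)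
    rw [nhdsWithin_eq_map_subtype_coe (show (0 : ℝ) ∈ Set.Ici (0 : ℝ) from Set.mem_Ici.2 le_rfl)]
    exact tendsto_map'_iff.2 this
  rw [eta_zero] at h1
  have h2 : Tendsto (fun t : ℝ => t⁻¹) atTop (𝓝[≥] 0) :=
    tendsto_inv_atTop_nhdsGT_zero.mono_right (nhdsWithin_mono _ Set.Ioi_subset_Ici_self)
  refine (h1.comp h2).congr' ?_
  filter_upwards [eventually_gt_atTop 0] with t ht
  exact (eta_swap hab ht).symm

theorem eta_continuousOn' (a b : K) : ContinuousOn (etp a b) (Set.Ici 0) :=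
  continuousOn_iff_continuous_domRestrict.2 (eta_continuousOn a b)

theorem bet_bset {a b c c' : K} {R : ℝ} (hab : a ≠ b) (ha : cl a ∈ bset c c' R)
    (hb : cl b ∈ bset c c' R) (y : BerkP1 K) (hy : Bet a b y) : y ∈ bset c c' R := by
  rw [mem_bset] at *
  rw [bkN_cl, bkN_cl, mul_div_assoc', div_lt_div_iff_of_pos_right (max_one_pos _)] at ha hb
  have hd : 0 < ‖a - b‖ := norm_pos_iff.2 (sub_ne_zero.2 hab)
  have hR : 0 < R := by
    by_contra h
    have := norm_nonneg (a - c)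
    have := norm_nonneg (a - c')
    nlinarith
  have h1 := hy c
  have h2 := hy c'
  rw [norm_sub_rev c b, norm_sub_rev c a] at h1
  rw [norm_sub_rev c' b, norm_sub_rev c' a] at h2
  have p := bkN_nonneg y a
  have q := bkN_nonneg y b
  have key : max (bkN y a * ‖b - c‖) (bkN y b * ‖a - c‖) <
      R * max (bkN y a * ‖b - c'‖) (bkN y b * ‖a - c'‖) := by
    rcases p.eq_or_lt with p0 | p0
    · have q0 := bkN_pos_or y hab p0.symm
      have h3 : bkN y b * ‖a - c‖ < bkN y b * (R * ‖a - c'‖) := by gcongr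
      rw [← p0, zero_mul, zero_mul, max_eq_right (by positivity), max_eq_right (by positivity)]
      linarith
    · have h4 : bkN y a * ‖b - c‖ < bkN y a * (R * ‖b - c'‖) := by gcongr
      rcases q.eq_or_lt with q0 | q0
      · rw [← q0, zero_mul, zero_mul, max_eq_left (by positivity), max_eq_left (by positivity)]
        linarith
      · have h3 : bkN y b * ‖a - c‖ < bkN y b * (R * ‖a - c'‖) := by gcongr
        have h5 : bkN y b * (R * ‖a - c'‖) ≤ R * max (bkN y a * ‖b - c'‖) (bkN y b * ‖a - c'‖) := by
          calc _ = R * (bkN y b * ‖a - c'‖) := by ring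
            _ ≤ _ := by gcongr; exact le_max_right _ _
        have h6 : bkN y a * (R * ‖b - c'‖) ≤ R * max (bkN y a * ‖b - c'‖) (bkN y b * ‖a - c'‖) := by
          calc _ = R * (bkN y a * ‖b - c'‖) := by ring
            _ ≤ _ := by gcongr; exact le_max_left _ _
        exact max_lt (h4.trans_le h6) (h3.trans_le h5)
  rw [← h1, ← h2] at key
  have : ‖a - b‖ * bkN y c < ‖a - b‖ * (R * bkN y c') := by linarith
  exact lt_of_mul_lt_mul_left this hd.le

end BerkGeometry3


section BerkGeometry4

variable {K}

set_option linter.unusedSectionVars false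
set_option linter.unusedVariables false

theorem exists_norm_between {lo hi : ℝ} (h0 : 0 < lo) (h : lo < hi) :
    ∃ g : K, lo < ‖g‖ ∧ ‖g‖ < hi := by
  obtain ⟨g, hg⟩ := exists_norm_gt (K := K) 1
  have hq : 1 < hi / lo := by rwa [one_lt_div h0]
  obtain ⟨n, hn⟩ := pow_unbounded_of_one_lt ‖g‖ hq
  have hn0 : 0 < n := by
    rcases Nat.eq_zero_or_pos n with rfl | h'
    · simp at hn; linarith
    · exact h'
  obtain ⟨z, hz⟩ := IsAlgClosed.exists_pow_nat_eq g hn0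
  have hz1 : 1 < ‖z‖ := by
    by_contra hcon
    push Not at hcon
    have := pow_le_one₀ (n := n) (norm_nonneg z) hcon
    rw [← norm_pow, hz] at this
    linarith
  have hz2 : ‖z‖ < hi / lo := by
    refine lt_of_pow_lt_pow_left₀ n (by positivity) ?_
    rw [← norm_pow, hz]
    exact hn
  obtain ⟨m, hm⟩ := exists_mem_Ico_zpow h0 hz1
  refine ⟨z ^ (m + 1), ?_, ?_⟩
  · rw [norm_zpow]; exact hm.2
  · rw [norm_zpow, zpow_add_one₀ (by linarith)]
    calc ‖z‖ ^ m * ‖z‖ ≤ lo * ‖z‖ := by gcongr; exact hm.1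
      _ < lo * (hi / lo) := by gcongr
      _ = hi := by field_simp

theorem exists_gap (S : Finset ℝ) {lo hi : ℝ} (h : lo < hi) :
    ∃ l, lo ≤ l ∧ l < hi ∧ ∀ r ∈ S, ¬ (l < r ∧ r < hi) := by
  induction S using Finset.induction_on with
  | empty => exact ⟨lo, le_rfl, h, by simp⟩
  | insert a s ha ih =>
    obtain ⟨l, h1, h2, h3⟩ := ih
    by_cases hl : l < a ∧ a < hi
    · refine ⟨a, by linarith [hl.1], hl.2, ?_⟩
      intro r hr
      rw [Finset.mem_insert] at hr
      rcases hr with rfl | hr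
      · intro h; exact lt_irrefl _ h.1
      · intro h; exact h3 r hr ⟨hl.1.trans h.1, h.2⟩
    · refine ⟨l, h1, h2, ?_⟩
      intro r hr
      rw [Finset.mem_insert] at hr
      rcases hr with rfl | hr
      · exact hl
      · exact h3 r hr

theorem bk_approx (y : BerkA1 K) (T : Finset K) {θ : ℝ} (h0 : 0 < θ) (h1 : θ < 1) :
    ∃ c : K, ∀ t ∈ T, θ * bkn y t ≤ ‖c - t‖ ∧ ‖c - t‖ ≤ bkn y t := by
  rcases T.eq_empty_or_nonempty with rfl | hT
  · exact ⟨0, by simp⟩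
  obtain ⟨c0, hc0, hmin⟩ := T.exists_min_image (bkn y) hT
  by_cases hex : ∃ c, bkn y c < bkn y c0
  · obtain ⟨c, hc⟩ := hex
    refine ⟨c, fun t ht => ?_⟩
    have hct : bkn y c < bkn y t := hc.trans_le (hmin t ht)
    have e1 := bkn_le y t c
    have e2 := bkn_sub_le y c t
    rw [max_eq_right hct.le] at e2
    have hn := bkn_nonneg y t
    refine ⟨?_, e2⟩
    rw [norm_sub_rev]
    rcases le_max_iff.1 e1 with h | h
    · linarith
    · nlinarith
  · push Not at hex
    have hval : ∀ t, bkn y t = max (bkn y c0) ‖c0 - t‖ := by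
      intro t
      apply le_antisymm
      · have := bkn_le y t c0
        rwa [norm_sub_rev] at this
      · apply max_le (hex t)
        have := bkn_sub_le y c0 t
        rwa [max_eq_right (hex t)] at this
    rcases (bkn_nonneg y c0).eq_or_lt with hs | hs
    · refine ⟨c0, fun t ht => ?_⟩
      rw [hval t, ← hs, max_eq_right (norm_nonneg _)]
      refine ⟨?_, le_rfl⟩
      have := norm_nonneg (c0 - t)
      nlinarith
    · have hlt : θ * bkn y c0 < bkn y c0 := by nlinarith
      obtain ⟨l, hl1, hl2, hl3⟩ := exists_gap (T.image fun t => ‖c0 - t‖) hlt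
      obtain ⟨g, hg1, hg2⟩ := exists_norm_between (K := K) (lt_of_lt_of_le (by positivity) hl1) hl2
      refine ⟨c0 + g, fun t ht => ?_⟩
      have hne : ‖g‖ ≠ ‖c0 - t‖ := by
        intro he
        refine hl3 ‖c0 - t‖ (Finset.mem_image_of_mem _ ht) ?_
        rw [← he]; exact ⟨hg1, hg2⟩
      have e : ‖c0 + g - t‖ = max ‖g‖ ‖c0 - t‖ := by
        rw [← IsUltrametricDist.norm_add_eq_max_of_norm_ne_norm hne]
        congr 1; ring
      rw [e, hval t]
      constructor
      · rw [mul_max_of_nonneg _ _ h0.le]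
        apply max_le_max
        · linarith
        · have := norm_nonneg (c0 - t)
          nlinarith
      · exact max_le_max hg2.le le_rfl

theorem cl_continuous : Continuous (cl : K → BerkP1 K) := by
  rw [bk_continuous_iff]
  intro c
  simp only [bkN_cl]
  refine Continuous.div (by fun_prop) (by fun_prop) ?_
  intro a
  exact (max_one_pos _).ne'

theorem exists_theta (T : Finset (ℝ × ℝ)) (h : ∀ k ∈ T, 0 ≤ k.1 ∧ k.1 < k.2) :
    ∃ θ : ℝ, 0 < θ ∧ θ < 1 ∧ ∀ k ∈ T, k.1 < θ * k.2 := by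
  have h1 : ∀ᶠ θ in 𝓝[<] (1 : ℝ), ∀ k ∈ T, k.1 < θ * k.2 := by
    rw [Filter.eventually_all_finset]
    intro k hk
    have : Tendsto (fun θ : ℝ => θ * k.2) (𝓝[<] 1) (𝓝 (1 * k.2)) :=
      (tendsto_nhdsWithin_of_tendsto_nhds tendsto_id).mul_const _
    rw [one_mul] at this
    exact this.eventually_const_lt (h k hk).2
  have h2 : ∀ᶠ θ in 𝓝[<] (1 : ℝ), 0 < θ :=
    nhdsWithin_le_nhds (lt_mem_nhds one_pos)
  obtain ⟨θ, hθ⟩ := (h1.and (h2.and self_mem_nhdsWithin)).exists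
  exact ⟨θ, hθ.2.1, hθ.2.2, hθ.1⟩

theorem cl_dense' {O : Set (BerkP1 K)} (hO : IsOpen O) (hne : O.Nonempty) : ∃ e : K, cl e ∈ O := by
  obtain ⟨x, hx⟩ := hne
  obtain ⟨T, hT0, hT1, hT2⟩ := bk_basis hO hx
  simp only [Set.mem_iInter, mem_bset] at hT1
  suffices h : ∃ e : K, ∀ k ∈ T, ‖e - k.1‖ < k.2.2 * ‖e - k.2.1‖ by
    obtain ⟨e, he⟩ := h
    refine ⟨e, hT2 ?_⟩
    simp only [Set.mem_iInter, mem_bset]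
    intro k hk
    rw [bkN_cl, bkN_cl, mul_div_assoc', div_lt_div_iff_of_pos_right (max_one_pos _)]
    exact he k hk
  induction x using OnePoint.rec with
  | infty =>
    simp only [bkN_infty, mul_one] at hT1
    obtain ⟨c, hc⟩ := exists_norm_gt (K := K) (max 1 (∑ k ∈ T, (‖k.1‖ + ‖k.2.1‖)))
    rw [max_lt_iff] at hc
    refine ⟨c, fun k hk => ?_⟩
    have hle : ‖k.1‖ + ‖k.2.1‖ ≤ ∑ k ∈ T, (‖k.1‖ + ‖k.2.1‖) :=
      Finset.single_le_sum (f := fun k : K × K × ℝ => ‖k.1‖ + ‖k.2.1‖)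
        (fun k _ => by positivity) hk
    have e : ∀ a : K, ‖a‖ < ‖c‖ → ‖c - a‖ = ‖c‖ := by
      intro a ha
      have := bkn_eq_norm (evalSeminorm K a) c (by rw [bkn_eval]; simpa using ha)
      rwa [bkn_eval, norm_sub_rev] at this
    have := norm_nonneg k.1
    have := norm_nonneg k.2.1
    rw [e k.1 (by linarith), e k.2.1 (by linarith)]
    have := hT1 k hk
    nlinarith
  | coe y =>
    have hT3 : ∀ k ∈ T, bkn y k.1 < k.2.2 * bkn y k.2.1 := by
      intro k hk
      have := hT1 k hk
      rwa [bkN_coe, bkN_coe, mul_div_assoc', div_lt_div_iff_of_pos_right (max_one_pos _)] at this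
    obtain ⟨θ, hθ0, hθ1, hθ⟩ := exists_theta (T.image fun k => (bkn y k.1, k.2.2 * bkn y k.2.1)) (by
      intro q hq
      rw [Finset.mem_image] at hq
      obtain ⟨k, hk, rfl⟩ := hq
      exact ⟨bkn_nonneg _ _, hT3 k hk⟩)
    obtain ⟨c, hc⟩ := bk_approx y (T.image (fun k => k.1) ∪ T.image fun k => k.2.1) hθ0 hθ1
    refine ⟨c, fun k hk => ?_⟩
    have a1 := (hc k.1 (Finset.mem_union_left _ (Finset.mem_image_of_mem _ hk))).2
    have a2 := (hc k.2.1 (Finset.mem_union_right _ (Finset.mem_image_of_mem (fun k => k.2.1) hk))).1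
    have a3 : bkn y k.1 < θ * (k.2.2 * bkn y k.2.1) :=
      hθ _ (Finset.mem_image_of_mem (fun k : K × K × ℝ => (bkn y k.1, k.2.2 * bkn y k.2.1)) hk)
    have := hT0 k hk
    calc ‖c - k.1‖ ≤ bkn y k.1 := a1
      _ < θ * (k.2.2 * bkn y k.2.1) := a3
      _ = k.2.2 * (θ * bkn y k.2.1) := by ring
      _ ≤ _ := by gcongr

theorem cl_dense {O : Set (BerkP1 K)} (hO : IsOpen O) (hne : O.Nonempty) (S : Set K)
    (hS : S.Finite) : ∃ e : K, cl e ∈ O ∧ e ∉ S := by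
  obtain ⟨e, he⟩ := cl_dense' hO hne
  have hopen : IsOpen (cl ⁻¹' O : Set K) := hO.preimage cl_continuous
  have hinf : (cl ⁻¹' O : Set K).Infinite := infinite_of_mem_nhds e (hopen.mem_nhds he)
  obtain ⟨z, hz1, hz2⟩ := hinf.exists_notMem_finite hS
  exact ⟨z, hz1, hz2⟩

theorem eta_nonclassical {a b : K} (hab : a ≠ b) {t : ℝ} (ht : 0 < t) (w : OnePoint K) :
    iota K w ≠ etp a b t := by
  intro h
  induction w using OnePoint.rec with
  | infty =>
    have h1 : iota K (OnePoint.infty : OnePoint K) = (OnePoint.infty : BerkP1 K) := rfl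
    rw [h1] at h
    unfold etp at h
    split_ifs at h <;> exact OnePoint.infty_ne_coe _ h
  | coe c =>
    have h1 : bkN (etp a b t) c = 0 := by
      rw [← h]; exact bkN_cl_self c
    rw [bkN_eta a b c ht.le, div_eq_zero_iff] at h1
    rcases h1 with h1 | h1
    · have h2 : t * ‖c - b‖ ≤ 0 := h1 ▸ le_max_left _ _
      have h3 : ‖c - a‖ ≤ 0 := h1 ▸ le_max_right _ _
      have h4 : c = a := by rw [norm_le_zero_iff, sub_eq_zero] at h3; exact h3
      have h5 : ‖c - b‖ ≤ 0 := by
        by_contra hcon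
        push Not at hcon
        have := mul_pos ht hcon
        linarith
      have h6 : c = b := by rw [norm_le_zero_iff, sub_eq_zero] at h5; exact h5
      exact hab (h4.symm.trans h6)
    · exact (etaden_pos a b t).ne' h1

theorem eta_path_preconnected (a b : K) : IsPreconnected (etp a b '' Set.Ici 0) :=
  isPreconnected_Ici.image _ (eta_continuousOn' a b)

theorem binter_preconnected (T : Finset (K × K × ℝ)) :
    IsPreconnected (⋂ k ∈ T, bset k.1 k.2.1 k.2.2 : Set (BerkP1 K)) := by
  set B : Set (BerkP1 K) := ⋂ k ∈ T, bset k.1 k.2.1 k.2.2 with hB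
  have hBo : IsOpen B := isOpen_biInter_finset fun k _ => bset_open _ _ _
  rcases B.eq_empty_or_nonempty with h | hne
  · rw [h]; exact isPreconnected_empty
  obtain ⟨e, he⟩ := cl_dense' hBo hne
  set P : K → Set (BerkP1 K) := fun e' => etp e e' '' Set.Ici 0 with hP
  set D : Set (BerkP1 K) := ⋃ e' : {e' : K // e' ≠ e ∧ cl e' ∈ B}, P e'.1 with hD
  have hDc : IsPreconnected D := by
    refine isPreconnected_iUnion ⟨cl e, Set.mem_iInter.2 fun i => ?_⟩ fun i => ?_
    · exact ⟨0, Set.mem_Ici.2 le_rfl, eta_zero _ _⟩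
    · exact eta_path_preconnected _ _
  have hDB : D ⊆ B := by
    intro y hy
    rw [hD, Set.mem_iUnion] at hy
    obtain ⟨⟨e', h1, h2⟩, t, ht, rfl⟩ := hy
    simp only [hB, Set.mem_iInter] at he h2 ⊢
    intro k hk
    exact bet_bset h1.symm (he k hk) (h2 k hk) _ (eta_bet _ _ ht)
  refine hDc.subset_closure hDB ?_
  have hcl : ∀ e', e' ≠ e → cl e' ∈ B → cl e' ∈ closure D := by
    intro e' h1 h2
    refine mem_closure_of_tendsto (eta_tendsto_infty h1.symm) ?_
    filter_upwards [eventually_ge_atTop 0] with t ht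
    exact Set.mem_iUnion.2 ⟨⟨e', h1, h2⟩, t, ht, rfl⟩
  intro y hy
  rw [← closure_closure, mem_closure_iff]
  intro O hO hyO
  obtain ⟨e', h1, h2⟩ := cl_dense (hO.inter hBo) ⟨y, hyO, hy⟩ {e} (Set.finite_singleton e)
  exact ⟨cl e', h1.1, hcl e' (by simpa using h2) h1.2⟩

instance bk_locallyConnected : LocallyConnectedSpace (BerkP1 K) := by
  refine locallyConnectedSpace_of_connected_bases
    (fun _ (T : Finset (K × K × ℝ)) => (⋂ k ∈ T, bset k.1 k.2.1 k.2.2 : Set (BerkP1 K)))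
    (fun x T => x ∈ (⋂ k ∈ T, bset k.1 k.2.1 k.2.2 : Set (BerkP1 K))) ?_ ?_
  · intro x
    refine ⟨fun s => ⟨fun hs => ?_, ?_⟩⟩
    · obtain ⟨O, hOs, hO, hxO⟩ := mem_nhds_iff.1 hs
      obtain ⟨T, _, h1, h2⟩ := bk_basis hO hxO
      exact ⟨T, h1, h2.trans hOs⟩
    · rintro ⟨T, h1, h2⟩
      exact mem_of_superset ((isOpen_biInter_finset fun k _ => bset_open _ _ _).mem_nhds h1) h2
  · intro x T _
    exact binter_preconnected T

end BerkGeometry4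


section BerkGeometry5

variable {K}

set_option linter.unusedSectionVars false
set_option linter.unusedVariables false

theorem nsub_pos {a b : K} (h : a ≠ b) : 0 < ‖a - b‖ := norm_pos_iff.2 (sub_ne_zero.2 h)

theorem pl_iso {a b c : K} {x : BerkP1 K} (h : ‖a - b‖ * bkN x c < bkN x a * ‖c - b‖) :
    bkN x a * ‖c - b‖ = bkN x b * ‖c - a‖ := by
  have h1 := bkN_pl x a b c
  have h2 := bkN_pl x b a c
  rw [norm_sub_rev c b] at h ⊢
  rw [norm_sub_rev c a]
  rw [norm_sub_rev b a] at h2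
  apply le_antisymm
  · rcases le_max_iff.1 h1 with h3 | h3
    · linarith
    · exfalso; linarith
  · rcases le_max_iff.1 h2 with h3 | h3 <;> linarith

theorem not_bet {a b : K} {y : BerkP1 K} (h : ¬ Bet a b y) :
    ∃ c, ‖a - b‖ * bkN y c < bkN y a * ‖c - b‖ := by
  unfold Bet at h
  push Not at h
  obtain ⟨c, hc⟩ := h
  refine ⟨c, ?_⟩
  have h0 := bkN_pl y c a b
  have h1 := bkN_pl y a b c
  have h2 := bkN_pl y b a c
  rw [norm_sub_rev b a] at h2
  rw [norm_sub_rev a c] at h1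
  rw [norm_sub_rev b c] at h2
  rw [norm_sub_rev b c] at h1
  rw [norm_sub_rev a c] at h2
  rw [mul_comm (bkN y a), mul_comm (bkN y b)] at hc
  rw [max_comm] at h0
  rw [max_comm] at hc
  have h3 : ‖a - b‖ * bkN y c < max (‖c - a‖ * bkN y b) (‖c - b‖ * bkN y a) := by
    refine lt_of_le_of_ne ?_ hc
    exact h0
  rw [mul_comm (bkN y a)]
  rcases lt_max_iff.1 h3 with h4 | h4
  · rcases le_max_iff.1 h2 with h5 | h5 <;> linarith
  · exact h4

theorem lemS {Y : Set (BerkP1 K)} (hY : IsPreconnected Y) {a b : K} (hab : a ≠ b) {t : ℝ}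
    (ht : 0 < t) {y1 y2 : BerkP1 K} (h1 : y1 ∈ Y) (h2 : y2 ∈ Y) (h3 : bkN y1 a < t * bkN y1 b)
    (h4 : t * bkN y2 b ≤ bkN y2 a) : etp a b t ∈ Y := by
  by_contra hcon
  set O1 : Set (BerkP1 K) := bset a b t with hO1
  set O2 : Set (BerkP1 K) := {x | t * bkN x b < bkN x a} ∪
    ⋃ c : {c : K // ‖c - a‖ = t * ‖c - b‖}, {x | ‖a - b‖ * bkN x c.1 < bkN x a * ‖c.1 - b‖} with hO2
  have o2 : IsOpen O2 := by
    refine (isOpen_lt (continuous_const.mul (bkN_continuous _)) (bkN_continuous _)).union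
      (isOpen_iUnion fun c => isOpen_lt (continuous_const.mul (bkN_continuous _))
        ((bkN_continuous _).mul continuous_const))
  have hbet : ∀ y ∈ Y, bkN y a = t * bkN y b → y ∈ O2 := by
    intro y hy he
    have hnb : ¬ Bet a b y := fun hb => hcon (eq_eta hab ht.le hb he ▸ hy)
    obtain ⟨c, hc⟩ := not_bet hnb
    have e := pl_iso hc
    right
    have hb0 : 0 < bkN y b := by
      refine lt_of_le_of_ne (bkN_nonneg y b) fun h0 => ?_
      rw [← h0, mul_zero] at he
      have := bkN_pos_or y hab he
      linarith
    refine Set.mem_iUnion.2 ⟨⟨c, ?_⟩, hc⟩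
    rw [he] at e
    have : bkN y b * ‖c - a‖ = bkN y b * (t * ‖c - b‖) := by linarith
    exact mul_left_cancel₀ hb0.ne' this
  have hcov : Y ⊆ O1 ∪ O2 := by
    intro y hy
    rcases lt_trichotomy (bkN y a) (t * bkN y b) with h | h | h
    · exact Or.inl h
    · exact Or.inr (hbet y hy h)
    · exact Or.inr (Or.inl h)
  obtain ⟨y, hy, hy1, hy2⟩ := hY O1 O2 (bset_open _ _ _) o2 hcov ⟨y1, h1, h3⟩
    ⟨y2, h2, by
      rcases h4.eq_or_lt with h | h
      · exact hbet y2 h2 h.symm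
      · exact Or.inl h⟩
  rw [hO1, mem_bset] at hy1
  rcases hy2 with hy2 | hy2
  · exact lt_asymm hy1 hy2
  · obtain ⟨⟨c, hc⟩, hy3⟩ := Set.mem_iUnion.1 hy2
    simp only [Set.mem_ofPred_eq] at hy3
    have e := pl_iso hy3
    rw [hc] at e
    have hp : 0 < ‖c - b‖ := by
      refine lt_of_le_of_ne (norm_nonneg _) fun h0 => ?_
      rw [← h0, mul_zero] at hy3
      have := mul_nonneg (norm_nonneg (a - b)) (bkN_nonneg y c)
      linarith
    have : bkN y a * ‖c - b‖ < (t * bkN y b) * ‖c - b‖ := by gcongr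
    linarith

/-- The parameter at which the path from `a` to `b` leaves `C`. -/
noncomputable def rad (C : Set (BerkP1 K)) (a b : K) : ℝ := sSup {t | 0 ≤ t ∧ etp a b t ∈ C}

theorem rad_spec {C : Set (BerkP1 K)} (hCo : IsOpen C) (hC : IsPreconnected C) {a b : K}
    (ha : cl a ∈ C) (hb : cl b ∉ closure C) :
    0 < rad C a b ∧ ∀ t, 0 ≤ t → (etp a b t ∈ C ↔ t < rad C a b) := by
  have hab : a ≠ b := by
    rintro rfl
    exact hb (subset_closure ha)
  set T : Set ℝ := {t | 0 ≤ t ∧ etp a b t ∈ C} with hT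
  have h0 : (0 : ℝ) ∈ T := ⟨le_rfl, by rw [eta_zero]; exact ha⟩
  have hdown : ∀ s ∈ T, ∀ t, 0 ≤ t → t ≤ s → t ∈ T := by
    intro s hs t ht hts
    rcases ht.eq_or_lt with rfl | ht0
    · exact h0
    refine ⟨ht, lemS hC hab ht0 ha hs.2 ?_ ?_⟩
    · rw [bkN_cl_self]
      have := bkN_cl_pos hab
      positivity
    · rw [eta_ratio a b hs.1]
      have := bkN_nonneg (etp a b s) b
      gcongr
  have hbdd : BddAbove T := by
    have h1 : ∀ᶠ t in atTop, etp a b t ∈ (closure C)ᶜ :=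
      (eta_tendsto_infty hab).eventually (isClosed_closure.isOpen_compl.mem_nhds hb)
    obtain ⟨M, hM⟩ := (h1.and (eventually_ge_atTop 0)).exists
    refine ⟨M, fun t ht => ?_⟩
    by_contra hlt
    push Not at hlt
    exact hM.1 (subset_closure (hdown t ht M hM.2 hlt.le).2)
  have hopen : ∀ s ∈ T, ∃ t ∈ T, s < t := by
    intro s hs
    have hcw : Tendsto (etp a b) (𝓝[>] s) (𝓝 (etp a b s)) :=
      ((eta_continuousOn' a b) s hs.1).mono_left
        (nhdsWithin_mono _ (fun z hz => hs.1.trans (le_of_lt hz)))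
    obtain ⟨t, ht1, ht2⟩ := ((hcw.eventually (hCo.mem_nhds hs.2)).and self_mem_nhdsWithin).exists
    exact ⟨t, ⟨hs.1.trans (le_of_lt ht2), ht1⟩, ht2⟩
  have hlt : ∀ s ∈ T, s < rad C a b := by
    intro s hs
    obtain ⟨t, ht, hst⟩ := hopen s hs
    exact hst.trans_le (le_csSup hbdd ht)
  refine ⟨hlt 0 h0, fun t ht => ⟨fun h => hlt t ⟨ht, h⟩, fun h => ?_⟩⟩
  obtain ⟨s, hs, hts⟩ := exists_lt_of_lt_csSup ⟨0, h0⟩ h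
  exact (hdown s hs t ht hts.le).2

theorem rad_lt {C : Set (BerkP1 K)} (hCo : IsOpen C) (hC : IsPreconnected C) {a b : K}
    (ha : cl a ∈ C) (hb : cl b ∉ closure C) {y : BerkP1 K} (hy : y ∈ C) :
    bkN y a < rad C a b * bkN y b := by
  have hab : a ≠ b := by
    rintro rfl
    exact hb (subset_closure ha)
  obtain ⟨h1, h2⟩ := rad_spec hCo hC ha hb
  by_contra hcon
  push Not at hcon
  have := lemS hC hab h1 ha hy (by rw [bkN_cl_self]; have := bkN_cl_pos hab; positivity) hcon
  exact lt_irrefl _ ((h2 _ h1.le).1 this)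

theorem rad_le {C : Set (BerkP1 K)} (hCo : IsOpen C) (hC : IsPreconnected C) {a b : K}
    (ha : cl a ∈ C) (hb : cl b ∉ closure C) {y : BerkP1 K} (hy : y ∈ closure C) :
    bkN y a ≤ rad C a b * bkN y b := by
  have hcl : IsClosed {y : BerkP1 K | bkN y a ≤ rad C a b * bkN y b} :=
    isClosed_le (bkN_continuous _) (continuous_const.mul (bkN_continuous _))
  exact closure_minimal (fun y hy => (rad_lt hCo hC ha hb hy).le) hcl hy

theorem rad_closure_eq {C : Set (BerkP1 K)} (hCo : IsOpen C) (hC : IsPreconnected C) {a b : K}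
    (ha : cl a ∈ C) (hb : cl b ∉ closure C) {y : BerkP1 K} (hy : y ∈ closure C)
    (he : bkN y a = rad C a b * bkN y b) : y = etp a b (rad C a b) := by
  have hab : a ≠ b := by
    rintro rfl
    exact hb (subset_closure ha)
  obtain ⟨h1, h2⟩ := rad_spec hCo hC ha hb
  apply eq_eta hab h1.le _ he
  by_contra hnb
  obtain ⟨c, hc⟩ := not_bet hnb
  have e := pl_iso hc
  have hopen : IsOpen {x : BerkP1 K | ‖a - b‖ * bkN x c < bkN x a * ‖c - b‖} :=
    isOpen_lt (continuous_const.mul (bkN_continuous _)) ((bkN_continuous _).mul continuous_const)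
  obtain ⟨z, hz1, hz2⟩ := mem_closure_iff.1 hy _ hopen hc
  have e' := pl_iso hz1
  have hlt := rad_lt hCo hC ha hb hz2
  rw [Set.mem_ofPred_eq] at hz1
  have hp : 0 < ‖c - b‖ := by
    refine lt_of_le_of_ne (norm_nonneg _) fun h0 => ?_
    rw [← h0, mul_zero] at hz1
    have := mul_nonneg (norm_nonneg (a - b)) (bkN_nonneg z c)
    linarith
  have hb0 : 0 < bkN y b := by
    refine lt_of_le_of_ne (bkN_nonneg y b) fun h0 => ?_
    rw [← h0, mul_zero] at he
    have := bkN_pos_or y hab he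
    linarith
  have hca : ‖c - a‖ = rad C a b * ‖c - b‖ := by
    rw [he] at e
    have : bkN y b * ‖c - a‖ = bkN y b * (rad C a b * ‖c - b‖) := by linarith
    exact mul_left_cancel₀ hb0.ne' this
  rw [hca] at e'
  have : bkN z a * ‖c - b‖ < (rad C a b * bkN z b) * ‖c - b‖ := by gcongr
  linarith

theorem rad_mem_closure {C : Set (BerkP1 K)} (hCo : IsOpen C) (hC : IsPreconnected C) {a b : K}
    (ha : cl a ∈ C) (hb : cl b ∉ closure C) : etp a b (rad C a b) ∈ closure C \ C := by
  obtain ⟨h1, h2⟩ := rad_spec hCo hC ha hb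
  refine ⟨?_, fun h => lt_irrefl _ ((h2 _ h1.le).1 h)⟩
  have hcw : Tendsto (etp a b) (𝓝[<] (rad C a b)) (𝓝 (etp a b (rad C a b))) := by
    have := ((eta_continuousOn' a b).continuousAt (Ici_mem_nhds h1)).tendsto
    exact this.mono_left nhdsWithin_le_nhds
  refine mem_closure_of_tendsto hcw ?_
  filter_upwards [self_mem_nhdsWithin, nhdsWithin_le_nhds (lt_mem_nhds h1)] with t ht ht0
  exact (h2 t (le_of_lt ht0)).2 ht

theorem notMem_closure_of_disjoint {C C' : Set (BerkP1 K)} (hC' : IsOpen C') (hd : Disjoint C C')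
    {z : BerkP1 K} (hz : z ∈ C') : z ∉ closure C := by
  intro h
  obtain ⟨w, hw1, hw2⟩ := mem_closure_iff.1 h C' hC' hz
  exact Set.disjoint_left.1 hd hw2 hw1

theorem pair_rad_le {C C' : Set (BerkP1 K)} (hCo : IsOpen C) (hC : IsPreconnected C)
    (hCo' : IsOpen C') (hC' : IsPreconnected C') (hd : Disjoint C C') {a b : K}
    (ha : cl a ∈ C) (hb : cl b ∈ C') : rad C a b * rad C' b a ≤ 1 := by
  have hb' := notMem_closure_of_disjoint hCo' hd hb
  have ha' := notMem_closure_of_disjoint hCo hd.symm ha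
  have hab : a ≠ b := by
    rintro rfl
    exact hb' (subset_closure ha)
  obtain ⟨h1, h2⟩ := rad_spec hCo hC ha hb'
  obtain ⟨h1', h2'⟩ := rad_spec hCo' hC' hb ha'
  by_contra hcon
  push Not at hcon
  have : (rad C' b a)⁻¹ < rad C a b := by rw [inv_lt_iff_one_lt_mul₀ h1']; linarith
  obtain ⟨t, ht1, ht2⟩ := exists_between this
  have ht0 : 0 < t := lt_trans (by positivity) ht1
  have m1 := (h2 t ht0.le).2 ht2
  have m2 := (h2' t⁻¹ (by positivity)).2 (by rwa [inv_lt_comm₀ ht0 h1'])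
  rw [← eta_swap hab ht0] at m2
  exact Set.disjoint_left.1 hd m1 m2

theorem pair_common {C C' : Set (BerkP1 K)} (hCo : IsOpen C) (hC : IsPreconnected C)
    (hCo' : IsOpen C') (hC' : IsPreconnected C') (hd : Disjoint C C') {a b : K}
    (ha : cl a ∈ C) (hb : cl b ∈ C') {y : BerkP1 K} (hy : y ∈ closure C) (hy' : y ∈ closure C') :
    y = etp a b (rad C a b) := by
  have hb' := notMem_closure_of_disjoint hCo' hd hb
  have ha' := notMem_closure_of_disjoint hCo hd.symm ha
  have hab : a ≠ b := by
    rintro rfl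
    exact hb' (subset_closure ha)
  obtain ⟨h1, h2⟩ := rad_spec hCo hC ha hb'
  obtain ⟨h1', h2'⟩ := rad_spec hCo' hC' hb ha'
  have e1 := rad_le hCo hC ha hb' hy
  have e2 := rad_le hCo' hC' hb ha' hy'
  have e3 := pair_rad_le hCo hC hCo' hC' hd ha hb
  apply rad_closure_eq hCo hC ha hb' hy
  apply le_antisymm e1
  calc rad C a b * bkN y b ≤ rad C a b * (rad C' b a * bkN y a) := by gcongr
    _ = (rad C a b * rad C' b a) * bkN y a := by ring
    _ ≤ 1 * bkN y a := by have := bkN_nonneg y a; gcongr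
    _ = _ := one_mul _

end BerkGeometry5


section BerkMap

variable {K}

set_option linter.unusedSectionVars false
set_option linter.unusedVariables false

theorem cl_denseRange : DenseRange (cl : K → BerkP1 K) := by
  intro x
  rw [mem_closure_iff]
  intro O hO hx
  obtain ⟨e, he⟩ := cl_dense' hO ⟨x, hx⟩
  exact ⟨cl e, he, e, rfl⟩

theorem eval_denseRange : DenseRange (evalSeminorm K) := by
  intro x
  rw [mem_closure_iff]
  intro O hO hx
  have hO' : IsOpen ((fun y : BerkA1 K => (y : BerkP1 K)) '' O) := OnePoint.isOpen_image_coe.2 hO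
  obtain ⟨e, y, hy, he⟩ := cl_dense' hO' ⟨_, x, hx, rfl⟩
  rw [cl_eq, OnePoint.coe_eq_coe] at he
  exact ⟨y, hy, e, he.symm⟩

/-- numerator of `f - a` -/
noncomputable def bG (f : RatFunc K) (a : K) : K[X] := f.num - C a * f.denom

theorem coprime_eval (f : RatFunc K) (c : K) (h : f.denom.eval c = 0) : f.num.eval c ≠ 0 := by
  intro h'
  obtain ⟨u, v, huv⟩ := RatFunc.isCoprime_num_denom f
  have := congrArg (eval c) huv
  simp [h, h'] at this

theorem bk_m_pos (f : RatFunc K) (x : BerkA1 K) : 0 < max (x.toFun f.num) (x.toFun f.denom) := by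
  rw [lt_max_iff]
  by_contra h
  push Not at h
  have h1 : x.toFun f.denom = 0 := le_antisymm h.2 (x.nonneg' _)
  obtain ⟨c, hc, rfl⟩ := bk_toFun_eq_zero x f.denom f.denom_ne_zero h1
  have h2 : ‖f.num.eval c‖ ≤ 0 := h.1
  rw [norm_le_zero_iff] at h2
  exact coprime_eval f c ((mem_roots f.denom_ne_zero).1 hc) h2

theorem bG_ne_zero (f : RatFunc K) (hd : 1 < rdeg K f) (a : K) : bG f a ≠ 0 := by
  intro h
  unfold bG at h
  rw [sub_eq_zero] at h
  have hu : IsUnit f.denom := by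
    have := RatFunc.isCoprime_num_denom f
    rw [h] at this
    exact (isCoprime_self.1 (IsCoprime.of_mul_left_right this))
  have h1 := natDegree_eq_zero_of_isUnit hu
  have h2 : f.num.natDegree ≤ f.denom.natDegree := by
    rw [h]; exact natDegree_C_mul_le _ _
  unfold rdeg at hd
  omega

theorem FN_cl (f : RatFunc K) (F : BerkP1 K → BerkP1 K)
    (hFext : ∀ w : OnePoint K, F (iota K w) = iota K (evalP1 K f w))
    (a w : K) : bkN (F (cl a)) w * max ‖f.num.eval a‖ ‖f.denom.eval a‖ =
    ‖(bG f w).eval a‖ := by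
  unfold cl
  rw [hFext]
  have e : evalP1 K f (a : OnePoint K) = if f.denom.eval a = 0 then OnePoint.infty
      else ((f.num.eval a / f.denom.eval a : K) : OnePoint K) := rfl
  rw [e]
  unfold bG
  split_ifs with h
  · have : iota K (OnePoint.infty : OnePoint K) = (OnePoint.infty : BerkP1 K) := rfl
    rw [this, bkN_infty]
    simp [h]
  · rw [bkN_iota]
    have h0 : 0 < ‖f.denom.eval a‖ := norm_pos_iff.2 h
    have e1 : max ‖f.num.eval a‖ ‖f.denom.eval a‖ =
        max 1 ‖f.num.eval a / f.denom.eval a‖ * ‖f.denom.eval a‖ := by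
      rw [norm_div, max_mul_of_nonneg _ _ h0.le, one_mul, div_mul_cancel₀ _ h0.ne', max_comm]
    rw [e1, ← mul_assoc, div_mul_cancel₀ _ (max_one_pos _).ne', ← norm_mul]
    congr 1
    simp only [eval_sub, eval_mul, eval_C]
    field_simp

theorem FN (f : RatFunc K) (F : BerkP1 K → BerkP1 K) (hFc : Continuous F)
    (hFext : ∀ w : OnePoint K, F (iota K w) = iota K (evalP1 K f w))
    (x : BerkA1 K) (w : K) :
    bkN (F x) w * max (x.toFun f.num) (x.toFun f.denom) = x.toFun (bG f w) := by
  have hc : IsClosed {x : BerkA1 K |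
      bkN (F x) w * max (x.toFun f.num) (x.toFun f.denom) = x.toFun (bG f w)} := by
    refine isClosed_eq ?_ (bk_continuous_toFun _)
    refine Continuous.mul ?_ ((bk_continuous_toFun _).max (bk_continuous_toFun _))
    exact (bkN_continuous w).comp (hFc.comp OnePoint.continuous_coe)
  have hsub : Set.range (evalSeminorm K) ⊆ {x : BerkA1 K |
      bkN (F x) w * max (x.toFun f.num) (x.toFun f.denom) = x.toFun (bG f w)} := by
    rintro _ ⟨a, rfl⟩
    exact FN_cl f F hFext a w
  exact closure_minimal hsub hc (eval_denseRange x)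

theorem F_nonclassical (f : RatFunc K) (F : BerkP1 K → BerkP1 K) (hFc : Continuous F)
    (hFext : ∀ w : OnePoint K, F (iota K w) = iota K (evalP1 K f w))
    (hd : 1 < rdeg K f) (x : BerkP1 K) (w : OnePoint K) (h : F x = iota K w) :
    ∃ w', iota K w' = x := by
  induction x using OnePoint.rec with
  | infty => exact ⟨OnePoint.infty, rfl⟩
  | coe y =>
    suffices hs : ∃ q : K[X], q ≠ 0 ∧ y.toFun q = 0 by
      obtain ⟨q, hq0, hq⟩ := hs
      obtain ⟨c, _, hc⟩ := bk_toFun_eq_zero y q hq0 hq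
      exact ⟨(c : OnePoint K), by rw [hc]; rfl⟩
    induction w using OnePoint.rec with
    | infty =>
      refine ⟨f.denom, f.denom_ne_zero, ?_⟩
      by_contra hne
      have hpos : 0 < y.toFun f.denom := lt_of_le_of_ne (y.nonneg' _) (Ne.symm hne)
      have h1 : ∀ w : K, y.toFun (bG f w) = max (y.toFun f.num) (y.toFun f.denom) := by
        intro w
        rw [← FN f F hFc hFext, h]
        have : iota K (OnePoint.infty : OnePoint K) = (OnePoint.infty : BerkP1 K) := rfl
        rw [this, bkN_infty, one_mul]
      obtain ⟨w, hw⟩ := exists_norm_gt (K := K)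
        (max (y.toFun f.num) (y.toFun f.denom) / y.toFun f.denom)
      rw [div_lt_iff₀ hpos] at hw
      have h2 : C w * f.denom = f.num + -(bG f w) := by unfold bG; ring
      have h3 := bk_ultra y f.num (-(bG f w))
      rw [← h2, bk_neg, h1, y.map_mul', y.restricts'] at h3
      have := le_max_left (y.toFun f.num) (y.toFun f.denom)
      rw [max_eq_right this] at h3
      linarith
    | coe w =>
      refine ⟨bG f w, bG_ne_zero f hd w, ?_⟩
      rw [← FN f F hFc hFext, h]
      have : bkN (iota K (w : OnePoint K)) w = 0 := bkN_cl_self w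
      rw [this, zero_mul]

theorem bG_natDegree (f : RatFunc K) (F : BerkP1 K → BerkP1 K)
    (hFext : ∀ w : OnePoint K, F (iota K w) = iota K (evalP1 K f w))
    (hd : 1 < rdeg K f) (a : K) (ha : cl a ≠ F OnePoint.infty) :
    (bG f a).natDegree = rdeg K f := by
  have e0 : F OnePoint.infty = iota K (evalP1 K f OnePoint.infty) := hFext OnePoint.infty
  rw [e0] at ha
  have e : evalP1 K f OnePoint.infty = if f.denom.natDegree < f.num.natDegree then OnePoint.infty
      else ((f.num.coeff f.denom.natDegree / f.denom.leadingCoeff : K) : OnePoint K) := rfl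
  rw [e] at ha
  unfold bG rdeg
  split_ifs at ha with h
  · rw [max_eq_left h.le]
    apply natDegree_sub_eq_left_of_natDegree_lt
    exact lt_of_le_of_lt (natDegree_C_mul_le _ _) h
  · push Not at h
    rw [max_eq_right h]
    apply natDegree_eq_of_le_of_coeff_ne_zero
    · exact (natDegree_sub_le _ _).trans (max_le h (natDegree_C_mul_le _ _))
    · have hl : f.denom.leadingCoeff ≠ 0 := leadingCoeff_ne_zero.2 f.denom_ne_zero
      intro h0
      apply ha
      unfold cl
      congr 2
      rw [coeff_sub, coeff_C_mul, sub_eq_zero] at h0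
      rw [h0, coeff_natDegree]
      field_simp

theorem bG_card_roots (f : RatFunc K) (F : BerkP1 K → BerkP1 K)
    (hFext : ∀ w : OnePoint K, F (iota K w) = iota K (evalP1 K f w))
    (hd : 1 < rdeg K f) (a : K) (ha : cl a ≠ F OnePoint.infty) :
    Multiset.card (bG f a).roots = rdeg K f := by
  rw [← bG_natDegree f F hFext hd a ha]
  exact (IsAlgClosed.splits _).natDegree_eq_card_roots.symm

theorem mem_bG_roots (f : RatFunc K) (F : BerkP1 K → BerkP1 K)
    (hFext : ∀ w : OnePoint K, F (iota K w) = iota K (evalP1 K f w))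
    (hd : 1 < rdeg K f) (a e : K) : e ∈ (bG f a).roots ↔ F (cl e) = cl a := by
  have h := FN_cl f F hFext e a
  have hm : 0 < max ‖f.num.eval e‖ ‖f.denom.eval e‖ := bk_m_pos f (evalSeminorm K e)
  rw [mem_roots (bG_ne_zero f hd a), IsRoot.def]
  constructor
  · intro h0
    rw [h0, norm_zero, mul_eq_zero] at h
    exact bkN_eq_zero _ _ (h.resolve_right hm.ne')
  · intro h0
    rw [h0, bkN_cl_self, zero_mul] at h
    exact norm_eq_zero.1 h.symm

theorem F_ratio (f : RatFunc K) (F : BerkP1 K → BerkP1 K) (hFc : Continuous F)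
    (hFext : ∀ w : OnePoint K, F (iota K w) = iota K (evalP1 K f w))
    (hd : 1 < rdeg K f) (a b : K) (ha : cl a ≠ F OnePoint.infty)
    (hb : cl b ≠ F OnePoint.infty) (x : BerkP1 K) :
    bkN (F x) a * (‖(bG f b).leadingCoeff‖ * ((bG f b).roots.map (bkN x)).prod) =
    bkN (F x) b * (‖(bG f a).leadingCoeff‖ * ((bG f a).roots.map (bkN x)).prod) := by
  have hcont : ∀ s : Multiset K, Continuous fun x : BerkP1 K => (s.map (bkN x)).prod := by
    intro s
    exact continuous_multiset_prod s fun i _ => bkN_continuous i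
  have hc : IsClosed {x : BerkP1 K |
      bkN (F x) a * (‖(bG f b).leadingCoeff‖ * ((bG f b).roots.map (bkN x)).prod) =
      bkN (F x) b * (‖(bG f a).leadingCoeff‖ * ((bG f a).roots.map (bkN x)).prod)} :=
    isClosed_eq (((bkN_continuous a).comp hFc).mul (continuous_const.mul (hcont _)))
      (((bkN_continuous b).comp hFc).mul (continuous_const.mul (hcont _)))
  refine closure_minimal (s := Set.range cl) ?_ hc (cl_denseRange x)
  rintro _ ⟨e, rfl⟩
  rw [Set.mem_ofPred_eq]
  have key : ∀ a, cl a ≠ F OnePoint.infty →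
      ‖(bG f a).leadingCoeff‖ * ((bG f a).roots.map (bkN (cl e))).prod =
      (evalSeminorm K e).toFun (bG f a) / (max 1 ‖e‖) ^ (rdeg K f) := by
    intro a ha
    rw [bk_toFun_eq, mul_div_assoc]
    congr 1
    have : (bkN (cl e) : K → ℝ) = fun c => bkn (evalSeminorm K e) c / max 1 ‖e‖ := by
      funext c
      rw [bkN_cl, bkn_eval]
    rw [this, Multiset.prod_map_div, Multiset.map_const', Multiset.prod_replicate,
      bG_card_roots f F hFext hd a ha]
  rw [key a ha, key b hb]
  have e1 := FN_cl f F hFext e a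
  have e2 := FN_cl f F hFext e b
  have e1' : (evalSeminorm K e).toFun (bG f a) = ‖(bG f a).eval e‖ := rfl
  have e2' : (evalSeminorm K e).toFun (bG f b) = ‖(bG f b).eval e‖ := rfl
  rw [e1', e2', ← e1, ← e2]
  ring

end BerkMap


section BerkDyn

variable {K}

set_option linter.unusedSectionVars false
set_option linter.unusedVariables false

/-- component of the complement of `J` -/
def cc (J : Set (BerkP1 K)) (y : BerkP1 K) : Set (BerkP1 K) := connectedComponentIn Jᶜ y

theorem cc_open {J : Set (BerkP1 K)} (hJ : IsClosed J) (y : BerkP1 K) : IsOpen (cc J y) :=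
  hJ.isOpen_compl.connectedComponentIn

theorem cc_pre (J : Set (BerkP1 K)) (y : BerkP1 K) : IsPreconnected (cc J y) :=
  isPreconnected_connectedComponentIn

theorem cc_sub (J : Set (BerkP1 K)) (y : BerkP1 K) : cc J y ⊆ Jᶜ :=
  connectedComponentIn_subset _ _

theorem cc_mem {J : Set (BerkP1 K)} {y : BerkP1 K} (hy : y ∈ Jᶜ) : y ∈ cc J y :=
  mem_connectedComponentIn hy

theorem cc_eq {J : Set (BerkP1 K)} {y z : BerkP1 K} (h : z ∈ cc J y) : cc J y = cc J z :=
  connectedComponentIn_eq h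

theorem cc_disjoint {J : Set (BerkP1 K)} {y z : BerkP1 K} (h : cc J y ≠ cc J z) :
    Disjoint (cc J y) (cc J z) := by
  rw [Set.disjoint_left]
  intro w h1 h2
  exact h ((cc_eq h1).trans (cc_eq h2).symm)

theorem cc_closure {J : Set (BerkP1 K)} (hJ : IsClosed J) {y z : BerkP1 K}
    (hz : z ∈ closure (cc J y)) (hzJ : z ∉ J) : z ∈ cc J y := by
  obtain ⟨w, hw1, hw2⟩ := mem_closure_iff.1 hz _ (cc_open hJ z) (cc_mem hzJ)
  rw [cc_eq hw2, ← cc_eq hw1]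
  exact cc_mem hzJ

theorem cc_frontier {J : Set (BerkP1 K)} (hJ : IsClosed J) (y : BerkP1 K) :
    frontier (cc J y) = closure (cc J y) ∩ J := by
  rw [frontier, (cc_open hJ y).interior_eq]
  ext z
  constructor
  · rintro ⟨h1, h2⟩
    refine ⟨h1, ?_⟩
    by_contra h3
    exact h2 (cc_closure hJ h1 h3)
  · rintro ⟨h1, h2⟩
    exact ⟨h1, fun h3 => cc_sub J y h3 h2⟩

theorem cc_map {J : Set (BerkP1 K)} {F : BerkP1 K → BerkP1 K} (hFc : Continuous F)
    (hFJ : F ⁻¹' J = J) {y : BerkP1 K} (hy : y ∈ Jᶜ) : F '' (cc J y) ⊆ cc J (F y) := by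
  refine ((cc_pre J y).image F hFc.continuousOn).subset_connectedComponentIn
    ⟨y, cc_mem hy, rfl⟩ ?_
  rintro _ ⟨z, hz, rfl⟩ h
  have : z ∈ F ⁻¹' J := h
  rw [hFJ] at this
  exact cc_sub J y hz this

theorem notMem_map {J : Set (BerkP1 K)} {F : BerkP1 K → BerkP1 K} (hFJ : F ⁻¹' J = J)
    {y : BerkP1 K} (hy : y ∈ Jᶜ) : F y ∈ Jᶜ := by
  intro h
  have : y ∈ F ⁻¹' J := h
  rw [hFJ] at this
  exact hy this

theorem notMem_iter {J : Set (BerkP1 K)} {F : BerkP1 K → BerkP1 K} (hFJ : F ⁻¹' J = J)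
    {y : BerkP1 K} (hy : y ∈ Jᶜ) (n : ℕ) : F^[n] y ∈ Jᶜ := by
  induction n with
  | zero => exact hy
  | succ n ih => rw [Function.iterate_succ_apply']; exact notMem_map hFJ ih

theorem cc_map_eq {J : Set (BerkP1 K)} {F : BerkP1 K → BerkP1 K} (hFc : Continuous F)
    (hFJ : F ⁻¹' J = J) {y z : BerkP1 K} (hy : y ∈ Jᶜ) (hz : z ∈ cc J y) :
    cc J (F z) = cc J (F y) :=
  (cc_eq (cc_map hFc hFJ hy ⟨z, hz, rfl⟩)).symm

theorem cc_map_eq' {J : Set (BerkP1 K)} {F : BerkP1 K → BerkP1 K} (hFc : Continuous F)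
    (hFJ : F ⁻¹' J = J) {y z : BerkP1 K} (hy : y ∈ Jᶜ) (hz : z ∈ Jᶜ) (h : cc J y = cc J z) :
    cc J (F y) = cc J (F z) :=
  (cc_map_eq hFc hFJ hy (h ▸ cc_mem hz)).symm

theorem cc_iter_eq {J : Set (BerkP1 K)} {F : BerkP1 K → BerkP1 K} (hFc : Continuous F)
    (hFJ : F ⁻¹' J = J) {y z : BerkP1 K} (hy : y ∈ Jᶜ) (hz : z ∈ Jᶜ) (h : cc J y = cc J z) (n : ℕ) :
    cc J (F^[n] y) = cc J (F^[n] z) := by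
  induction n with
  | zero => exact h
  | succ n ih =>
    rw [Function.iterate_succ_apply', Function.iterate_succ_apply']
    exact cc_map_eq' hFc hFJ (notMem_iter hFJ hy n) (notMem_iter hFJ hz n) ih

theorem cc_frontier_map {J : Set (BerkP1 K)} (hJ : IsClosed J) {F : BerkP1 K → BerkP1 K}
    (hFc : Continuous F) (hFJ : F ⁻¹' J = J) {y : BerkP1 K} (hy : y ∈ Jᶜ) :
    frontier (cc J y) ⊆ F ⁻¹' (frontier (cc J (F y))) := by
  rw [cc_frontier hJ, cc_frontier hJ]
  rintro z ⟨h1, h2⟩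
  refine ⟨closure_mono (cc_map hFc hFJ hy) ?_, ?_⟩
  · exact image_closure_subset_closure_image hFc ⟨z, h1, rfl⟩
  · have : z ∈ F ⁻¹' J := by rw [hFJ]; exact h2
    exact this

theorem cc_frontier_measure {J : Set (BerkP1 K)} (hJ : IsClosed J) {F : BerkP1 K → BerkP1 K}
    (hFc : Continuous F) (hFJ : F ⁻¹' J = J) (μ : Measure (BerkP1 K))
    (hinv : ∀ A : Set (BerkP1 K), MeasurableSet A → μ (F ⁻¹' A) = μ A)
    {y : BerkP1 K} (hy : y ∈ Jᶜ) : μ (frontier (cc J y)) ≤ μ (frontier (cc J (F y))) := by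
  rw [← hinv (frontier (cc J (F y))) isClosed_frontier.measurableSet]
  exact measure_mono (cc_frontier_map hJ hFc hFJ hy)

theorem cc_frontier_measure_iter {J : Set (BerkP1 K)} (hJ : IsClosed J) {F : BerkP1 K → BerkP1 K}
    (hFc : Continuous F) (hFJ : F ⁻¹' J = J) (μ : Measure (BerkP1 K))
    (hinv : ∀ A : Set (BerkP1 K), MeasurableSet A → μ (F ⁻¹' A) = μ A)
    {y : BerkP1 K} (hy : y ∈ Jᶜ) (n : ℕ) :
    μ (frontier (cc J y)) ≤ μ (frontier (cc J (F^[n] y))) := by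
  induction n with
  | zero => exact le_rfl
  | succ n ih =>
    rw [Function.iterate_succ_apply']
    exact ih.trans (cc_frontier_measure hJ hFc hFJ μ hinv (notMem_iter hFJ hy n))

theorem msupport_closed (μ : Measure (BerkP1 K)) : IsClosed (msupport K μ) := by
  rw [← isOpen_compl_iff, isOpen_iff_forall_mem_open]
  intro x hx
  have hx' : ¬ ∀ U : Set (BerkP1 K), IsOpen U → x ∈ U → 0 < μ U := hx
  push Not at hx'
  obtain ⟨U, hU, hxU, h0⟩ := hx'
  refine ⟨U, ?_, hU, hxU⟩
  intro z hz hzs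
  exact absurd (hzs U hU hz) (not_lt.2 h0)

theorem msupport_compl_null (μ : Measure (BerkP1 K)) [IsProbabilityMeasure μ] [μ.Regular] :
    μ (msupport K μ)ᶜ = 0 := by
  rw [(msupport_closed μ).isOpen_compl.measure_eq_iSup_isCompact]
  simp only [ENNReal.iSup_eq_zero]
  intro S hS hSc
  refine hSc.measure_zero_of_nhdsWithin fun x hx => ?_
  have hx' : ¬ ∀ U : Set (BerkP1 K), IsOpen U → x ∈ U → 0 < μ U := hS hx
  push Not at hx'
  obtain ⟨U, hU, hxU, h0⟩ := hx'
  exact ⟨U, mem_nhdsWithin_of_mem_nhds (hU.mem_nhds hxU), le_antisymm h0 bot_le⟩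

theorem cc_periodic {J : Set (BerkP1 K)} {F : BerkP1 K → BerkP1 K} (hFc : Continuous F)
    (hFJ : F ⁻¹' J = J) {x : BerkP1 K} (hx : x ∈ Jᶜ) {p : ℕ} (hper : F^[p] '' (cc J x) = cc J x)
    (j : ℕ) : cc J (F^[j + p] x) = cc J (F^[j] x) := by
  rw [Function.iterate_add_apply]
  refine cc_iter_eq hFc hFJ (notMem_iter hFJ hx p) hx ?_ j
  have : F^[p] x ∈ cc J x := by
    rw [← hper]
    exact ⟨x, cc_mem hx, rfl⟩
  exact (cc_eq this).symm

theorem support_eq (μ : Measure (BerkP1 K)) [IsProbabilityMeasure μ] {F : BerkP1 K → BerkP1 K}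
    (hFc : Continuous F) (hFJ : F ⁻¹' msupport K μ = msupport K μ)
    (hinv : ∀ A : Set (BerkP1 K), MeasurableSet A → μ (F ⁻¹' A) = μ A)
    (herg : ∀ A : Set (BerkP1 K), MeasurableSet A → F ⁻¹' A = A → μ A = 0 ∨ μ A = 1)
    {x : BerkP1 K} (hx : x ∈ (msupport K μ)ᶜ) {p : ℕ} (hp : 0 < p)
    (hper : F^[p] '' (cc (msupport K μ) x) = cc (msupport K μ) x)
    (hne : μ (frontier (cc (msupport K μ) x)) ≠ 0) :
    msupport K μ = ⋃ j ∈ Finset.range p, frontier (cc (msupport K μ) (F^[j] x)) := by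
  set J := msupport K μ with hJdef
  have hJ : IsClosed J := msupport_closed μ
  set B : Set (BerkP1 K) := ⋃ j ∈ Finset.range p, frontier (cc J (F^[j] x)) with hB
  have hBc : IsClosed B := by
    apply Set.Finite.isClosed_biUnion (Finset.finite_toSet _)
    intro j _
    exact isClosed_frontier
  have hBJ : B ⊆ J := by
    intro z hz
    simp only [hB, Set.mem_iUnion] at hz
    obtain ⟨j, _, hz⟩ := hz
    rw [cc_frontier hJ] at hz
    exact hz.2
  have hBF : B ⊆ F ⁻¹' B := by
    intro z hz
    simp only [hB, Set.mem_iUnion] at hz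
    obtain ⟨j, hj, hz⟩ := hz
    have h1 := cc_frontier_map hJ hFc hFJ (notMem_iter hFJ hx j) hz
    rw [← Function.iterate_succ_apply' F] at h1
    rw [Finset.mem_range] at hj
    change F z ∈ B
    simp only [hB, Set.mem_iUnion]
    rcases Nat.lt_or_ge (j + 1) p with h2 | h2
    · exact ⟨j + 1, Finset.mem_range.2 h2, h1⟩
    · have h3 : j.succ = 0 + p := by omega
      rw [h3, Set.mem_preimage, cc_periodic hFc hFJ hx hper 0] at h1
      exact ⟨0, Finset.mem_range.2 hp, h1⟩
  have hmono : ∀ n, F^[n] ⁻¹' B ⊆ F^[n + 1] ⁻¹' B := by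
    intro n z hz
    have : F (F^[n] z) ∈ B := hBF hz
    rw [← Function.iterate_succ_apply' F] at this
    exact this
  have hmeas : ∀ n, MeasurableSet (F^[n] ⁻¹' B) := fun n =>
    (hBc.preimage (hFc.iterate n)).measurableSet
  have hmu : ∀ n, μ (F^[n] ⁻¹' B) = μ B := by
    intro n
    induction n with
    | zero => rfl
    | succ n ih =>
      rw [← ih, ← hinv _ (hmeas n)]
      rfl
  set A : Set (BerkP1 K) := ⋃ n, F^[n] ⁻¹' B with hA
  have hAinv : F ⁻¹' A = A := by
    rw [hA, Set.preimage_iUnion]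
    apply Set.Subset.antisymm
    · refine Set.iUnion_subset fun n => ?_
      exact Set.subset_iUnion (fun n => F^[n] ⁻¹' B) (n + 1)
    · refine Set.iUnion_subset fun n => ?_
      exact (hmono n).trans (Set.subset_iUnion (fun n => F ⁻¹' (F^[n] ⁻¹' B)) n)
  have hmuA : μ A = μ B := by
    have hm : Monotone fun n => F^[n] ⁻¹' B := monotone_nat_of_le_succ hmono
    rw [hA, hm.measure_iUnion]
    simp [hmu]
  have hB1 : μ B = 1 := by
    rcases herg A (MeasurableSet.iUnion hmeas) hAinv with h | h
    · exfalso
      apply hne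
      rw [← nonpos_iff_eq_zero, ← h, hmuA]
      apply measure_mono
      intro z hz
      simp only [hB, Set.mem_iUnion]
      exact ⟨0, Finset.mem_range.2 hp, hz⟩
    · rw [← hmuA, h]
  apply Set.Subset.antisymm _ hBJ
  intro z hz
  by_contra hzB
  have h0 := hz Bᶜ hBc.isOpen_compl hzB
  rw [prob_compl_eq_zero_iff hBc.measurableSet |>.2 hB1] at h0
  exact lt_irrefl _ h0

end BerkDyn


section BerkCaseA

variable {K}

set_option linter.unusedSectionVars false
set_option linter.unusedVariables false

theorem prod_monomial {a e : K} (hae : e ≠ a) {r : ℝ} (hr : 0 < r) (s : Multiset K) :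
    ∃ A : ℝ, 0 < A ∧ ∀ᶠ t in 𝓝[<] r, (s.map fun c => max (t * ‖c - a‖) ‖c - e‖).prod =
      A * t ^ (s.countP fun c => ‖c - e‖ < r * ‖c - a‖) := by
  induction s using Multiset.induction_on with
  | empty => exact ⟨1, one_pos, by simp⟩
  | cons c s ih =>
    obtain ⟨A, hA, h⟩ := ih
    by_cases hc : ‖c - e‖ < r * ‖c - a‖
    · have hp : 0 < ‖c - a‖ := by
        by_contra h0
        have : ‖c - a‖ = 0 := le_antisymm (not_lt.1 h0) (norm_nonneg _)
        rw [this, mul_zero] at hc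
        exact absurd hc (not_lt.2 (norm_nonneg _))
      refine ⟨‖c - a‖ * A, by positivity, ?_⟩
      have h1 : ∀ᶠ t in 𝓝[<] r, ‖c - e‖ / ‖c - a‖ < t := by
        apply nhdsWithin_le_nhds
        apply lt_mem_nhds
        rwa [div_lt_iff₀ hp]
      filter_upwards [h, h1] with t ht ht1
      rw [div_lt_iff₀ hp] at ht1
      rw [Multiset.map_cons, Multiset.prod_cons, ht, Multiset.countP_cons_of_pos (p := fun c => ‖c - e‖ < r * ‖c - a‖) _ hc,
        max_eq_left ht1.le]
      ring
    · have hc' := not_lt.1 hc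
      have hp : 0 < ‖c - e‖ := by
        by_contra h0
        have h1 : ‖c - e‖ = 0 := le_antisymm (not_lt.1 h0) (norm_nonneg _)
        have h2 : c = e := by rwa [norm_eq_zero, sub_eq_zero] at h1
        have h3 : 0 < ‖c - a‖ := by rw [h2]; exact nsub_pos hae
        have := mul_pos hr h3
        linarith
      refine ⟨‖c - e‖ * A, by positivity, ?_⟩
      filter_upwards [h, self_mem_nhdsWithin] with t ht ht1
      have h4 : t * ‖c - a‖ ≤ r * ‖c - a‖ :=
        mul_le_mul_of_nonneg_right (le_of_lt ht1) (norm_nonneg _)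
      rw [Multiset.map_cons, Multiset.prod_cons, ht, Multiset.countP_cons_of_neg (p := fun c => ‖c - e‖ < r * ‖c - a‖) _ hc,
        max_eq_right (h4.trans hc')]
      ring

theorem exponent_eq {A B r : ℝ} (hA : 0 < A) (hB : 0 < B) (hr : 0 < r) {m n : ℕ}
    (h : ∀ᶠ t in 𝓝[<] r, A * t ^ m = B * t ^ n) : m = n := by
  have h' : ∀ᶠ t in 𝓝[<] r, A * t ^ m = B * t ^ n ∧ 0 < t :=
    h.and (nhdsWithin_le_nhds (lt_mem_nhds hr))
  obtain ⟨l, hl, hsub⟩ := (mem_nhdsLT_iff_exists_Ioo_subset' hr).1 h'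
  have hl' : l < r := hl
  obtain ⟨t1, ht1, ht1'⟩ := exists_between hl'
  obtain ⟨t2, ht2, ht2'⟩ := exists_between ht1'
  obtain ⟨e1, p1⟩ := hsub ⟨ht1, ht1'⟩
  obtain ⟨e2, p2⟩ := hsub ⟨ht1.trans ht2, ht2'⟩
  have hq : (t1 / t2) ^ m = (t1 / t2) ^ n := by
    rw [div_pow, div_pow, div_eq_div_iff (by positivity) (by positivity)]
    have : (A * B) * (t1 ^ m * t2 ^ n) = (A * B) * (t1 ^ n * t2 ^ m) := by
      calc _ = (A * t1 ^ m) * (B * t2 ^ n) := by ring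
        _ = (B * t1 ^ n) * (A * t2 ^ m) := by rw [e1, e2]
        _ = _ := by ring
    exact mul_left_cancel₀ (by positivity) this
  exact (pow_right_inj₀ (by positivity) ((div_lt_one p2).2 ht2).ne).1 hq

theorem bet_isClosed (a b : K) : IsClosed {y : BerkP1 K | Bet a b y} := by
  unfold Bet
  simp only [Set.ofPred_forall]
  refine isClosed_iInter fun c => ?_
  exact isClosed_eq (continuous_const.mul (bkN_continuous _))
    (((bkN_continuous _).mul continuous_const).max ((bkN_continuous _).mul continuous_const))

theorem bet_of_far {e a c : K} (hea : e ≠ a) (hec : e ≠ c) {r : ℝ} (hr : 0 < r)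
    (h : r * ‖c - a‖ ≤ ‖c - e‖) : Bet e c (etp e a r) := by
  have hsub : closure (etp e c '' Set.Ici 0) ⊆ {y | Bet e c y} := by
    refine closure_minimal ?_ (bet_isClosed e c)
    rintro _ ⟨t, ht, rfl⟩
    exact eta_bet _ _ ht
  apply hsub
  have hcl : cl c ∈ closure (etp e c '' Set.Ici 0) := by
    refine mem_closure_of_tendsto (eta_tendsto_infty hec) ?_
    filter_upwards [eventually_ge_atTop 0] with t ht
    exact ⟨t, ht, rfl⟩
  have hcl0 : cl e ∈ closure (etp e c '' Set.Ici 0) :=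
    subset_closure ⟨0, Set.mem_Ici.2 le_rfl, eta_zero _ _⟩
  refine lemS (eta_path_preconnected e c).closure hea hr hcl0 hcl ?_ ?_
  · rw [bkN_cl_self]
    have := bkN_cl_pos hea
    positivity
  · rw [bkN_cl, bkN_cl, mul_div_assoc']
    exact div_le_div_of_nonneg_right h (max_one_pos _).le

/-- If `y ∈ closure C \ C` lies beyond on the path towards `c`, it is the exit point. -/
theorem exit_unique {C : Set (BerkP1 K)} (hCo : IsOpen C) (hC : IsPreconnected C) {e a c : K}
    (he : cl e ∈ C) (hc : cl c ∉ closure C) (hea : e ≠ a) {r : ℝ} (hr : 0 < r)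
    (hy : etp e a r ∈ closure C \ C) (h : r * ‖c - a‖ ≤ ‖c - e‖) :
    etp e a r = etp e c (rad C e c) := by
  have hec : e ≠ c := by
    rintro rfl
    exact hc (subset_closure he)
  have hb := bet_of_far hea hec hr h
  have hpos : 0 < bkN (etp e a r) c := bkN_pos_of_ne (eta_nonclassical hea hr (c : OnePoint K)).symm
  obtain ⟨h1, h2⟩ := rad_spec hCo hC he hc
  apply rad_closure_eq hCo hC he hc hy.1
  apply le_antisymm (rad_le hCo hC he hc hy.1)
  by_contra hcon
  push Not at hcon
  have h0 : 0 ≤ bkN (etp e a r) e / bkN (etp e a r) c := div_nonneg (bkN_nonneg _ _) hpos.le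
  have e1 : etp e a r = etp e c (bkN (etp e a r) e / bkN (etp e a r) c) := by
    apply eq_eta hec h0 hb
    rw [div_mul_cancel₀ _ hpos.ne']
  apply hy.2
  rw [e1]
  rw [h2 _ h0, div_lt_iff₀ hpos]
  exact hcon

theorem exit_exists {C : Set (BerkP1 K)} (hCo : IsOpen C) (hC : IsPreconnected C) {e a c : K}
    (he : cl e ∈ C) (hc : cl c ∉ closure C) (hea : e ≠ a) {r : ℝ} (hr : 0 < r)
    (h : etp e a r = etp e c (rad C e c)) : r * ‖c - a‖ ≤ ‖c - e‖ := by
  obtain ⟨h1, h2⟩ := rad_spec hCo hC he hc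
  have hb : Bet e c (etp e a r) := by rw [h]; exact eta_bet _ _ h1.le
  have hpos := bkN_eta_pos_right hea hr.le
  have e1 := hb a
  have e2 := eta_ratio e a hr.le
  have e3 : bkN (etp e a r) e * ‖a - c‖ ≤ ‖e - c‖ * bkN (etp e a r) a := by
    rw [e1]; exact le_max_left _ _
  rw [e2] at e3
  rw [norm_sub_rev c a, norm_sub_rev c e]
  have : bkN (etp e a r) a * (r * ‖a - c‖) ≤ bkN (etp e a r) a * ‖e - c‖ := by linarith
  exact le_of_mul_le_mul_left this hpos

theorem finite_fiber (f : RatFunc K) (F : BerkP1 K → BerkP1 K)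
    (hFext : ∀ w : OnePoint K, F (iota K w) = iota K (evalP1 K f w)) (hd : 1 < rdeg K f)
    (w : OnePoint K) : {e : K | F (cl e) = iota K w}.Finite := by
  induction w using OnePoint.rec with
  | infty =>
    refine (f.denom.roots.toFinset.finite_toSet).subset ?_
    intro e he
    have h1 : F (cl e) = iota K (OnePoint.infty) := he
    simp only [Finset.mem_coe, Multiset.mem_toFinset, mem_roots f.denom_ne_zero, IsRoot.def]
    by_contra hne
    unfold cl at h1
    rw [hFext] at h1
    have e : evalP1 K f (e : OnePoint K) = if f.denom.eval e = 0 then OnePoint.infty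
      else ((f.num.eval e / f.denom.eval e : K) : OnePoint K) := rfl
    rw [e, if_neg hne] at h1
    exact OnePoint.coe_ne_infty _ h1
  | coe a =>
    refine ((bG f a).roots.toFinset.finite_toSet).subset ?_
    intro e he
    have h1 : F (cl e) = cl a := he
    simp only [Finset.mem_coe, Multiset.mem_toFinset]
    exact (mem_bG_roots f F hFext hd a e).2 h1

/-- Choice of a good classical point in an open set. -/
theorem good_point (f : RatFunc K) (F : BerkP1 K → BerkP1 K)
    (hFext : ∀ w : OnePoint K, F (iota K w) = iota K (evalP1 K f w)) (hd : 1 < rdeg K f)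
    {O : Set (BerkP1 K)} (hO : IsOpen O) (hne : O.Nonempty) :
    ∃ e a : K, cl e ∈ O ∧ F (cl e) = cl a ∧ cl a ≠ F OnePoint.infty := by
  have e0 : F OnePoint.infty = iota K (evalP1 K f OnePoint.infty) := hFext OnePoint.infty
  obtain ⟨e, he, he'⟩ := cl_dense hO hne _ ((finite_fiber f F hFext hd OnePoint.infty).union
    (finite_fiber f F hFext hd (evalP1 K f OnePoint.infty)))
  have h1 : F (cl e) = iota K (evalP1 K f e) := hFext e
  cases hw : evalP1 K f (e : OnePoint K) using OnePoint.rec with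
  | infty =>
    exfalso
    rw [hw] at h1
    exact he' (Or.inl h1)
  | coe a =>
    rw [hw] at h1
    refine ⟨e, a, he, h1, fun h2 => he' (Or.inr ?_)⟩
    rw [Set.mem_ofPred_eq, ← e0, ← h2]
    exact h1

end BerkCaseA


section BerkCaseAMain

variable {K}

set_option linter.unusedSectionVars false
set_option linter.unusedVariables false

theorem prod_eta (e a : K) {t : ℝ} (ht : 0 ≤ t) (s : Multiset K) :
    (s.map (bkN (etp e a t))).prod * etaden e a t ^ (Multiset.card s) =
      (s.map fun c => max (t * ‖c - a‖) ‖c - e‖).prod := by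
  have hpos := etaden_pos e a t
  induction s using Multiset.induction_on with
  | empty => simp
  | cons c s ih =>
    rw [Multiset.map_cons, Multiset.prod_cons, Multiset.map_cons, Multiset.prod_cons,
      Multiset.card_cons, ← ih, bkN_eta e a c ht]
    field_simp
    ring

theorem count_local (f : RatFunc K) (F : BerkP1 K → BerkP1 K) (hFc : Continuous F)
    (hFext : ∀ w : OnePoint K, F (iota K w) = iota K (evalP1 K f w))
    (hd : 1 < rdeg K f) {a' b' : K} (ha : cl a' ≠ F OnePoint.infty)
    (hb : cl b' ≠ F OnePoint.infty) {e a : K} (hea : e ≠ a) {r : ℝ} (hr : 0 < r)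
    (h1 : F (etp e a r) ≠ cl a') (h2 : F (etp e a r) ≠ cl b')
    (hnb : ¬ Bet a' b' (F (etp e a r))) :
    (bG f a').roots.countP (fun c => ‖c - e‖ < r * ‖c - a‖) =
      (bG f b').roots.countP (fun c => ‖c - e‖ < r * ‖c - a‖) := by
  obtain ⟨c0, hc0⟩ := not_bet hnb
  have p1 := bkN_pos_of_ne h1
  have p2 := bkN_pos_of_ne h2
  have q1 : 0 < ‖c0 - b'‖ := by
    by_contra h0
    have h0' : ‖c0 - b'‖ = 0 := le_antisymm (not_lt.1 h0) (norm_nonneg _)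
    rw [h0', mul_zero] at hc0
    exact absurd hc0 (not_lt.2 (mul_nonneg (norm_nonneg _) (bkN_nonneg _ _)))
  have q2 : 0 < ‖c0 - a'‖ := by
    have h3 := pl_iso hc0
    have h4 : 0 < bkN (F (etp e a r)) b' * ‖c0 - a'‖ := by rw [← h3]; positivity
    exact (pos_iff_pos_of_mul_pos h4).1 p2
  have hcw : Tendsto (fun t => F (etp e a t)) (𝓝[<] r) (𝓝 (F (etp e a r))) := by
    have := ((eta_continuousOn' e a).continuousAt (Ici_mem_nhds hr)).tendsto
    exact (hFc.continuousAt.tendsto.comp this).mono_left nhdsWithin_le_nhds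
  have o1 : IsOpen {y : BerkP1 K | ‖a' - b'‖ * bkN y c0 < bkN y a' * ‖c0 - b'‖} :=
    isOpen_lt (continuous_const.mul (bkN_continuous _)) ((bkN_continuous _).mul continuous_const)
  have o2 : IsOpen {y : BerkP1 K | 0 < bkN y b'} := isOpen_lt continuous_const (bkN_continuous _)
  have ev1 := hcw.eventually (o1.mem_nhds hc0)
  have ev2 := hcw.eventually (o2.mem_nhds p2)
  obtain ⟨A, hA, evA⟩ := prod_monomial hea hr (bG f a').roots
  obtain ⟨B, hB, evB⟩ := prod_monomial hea hr (bG f b').roots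
  have la : 0 < ‖(bG f a').leadingCoeff‖ :=
    norm_pos_iff.2 (leadingCoeff_ne_zero.2 (bG_ne_zero f hd a'))
  have lb : 0 < ‖(bG f b').leadingCoeff‖ :=
    norm_pos_iff.2 (leadingCoeff_ne_zero.2 (bG_ne_zero f hd b'))
  refine exponent_eq (A := ‖c0 - b'‖ * ‖(bG f a').leadingCoeff‖ * A)
    (B := ‖c0 - a'‖ * ‖(bG f b').leadingCoeff‖ * B) (by positivity) (by positivity) hr ?_
  filter_upwards [ev1, ev2, evA, evB, nhdsWithin_le_nhds (lt_mem_nhds hr)] with t e1 e2 eA eB ht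
  have hiso := pl_iso (show ‖a' - b'‖ * bkN (F (etp e a t)) c0 < bkN (F (etp e a t)) a' * ‖c0 - b'‖
    from e1)
  have e2' : 0 < bkN (F (etp e a t)) b' := e2
  have hR := F_ratio f F hFc hFext hd a' b' ha hb (etp e a t)
  have hpa := prod_eta e a (le_of_lt ht) (bG f a').roots
  have hpb := prod_eta e a (le_of_lt ht) (bG f b').roots
  rw [bG_card_roots f F hFext hd _ ha, eA] at hpa
  rw [bG_card_roots f F hFext hd _ hb, eB] at hpb
  set P := ((bG f a').roots.map (bkN (etp e a t))).prod
  set Q := ((bG f b').roots.map (bkN (etp e a t))).prod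
  set la' := ‖(bG f a').leadingCoeff‖
  set lb' := ‖(bG f b').leadingCoeff‖
  set E := etaden e a t ^ rdeg K f
  set na := bkN (F (etp e a t)) a'
  set nb := bkN (F (etp e a t)) b'
  rw [mul_assoc _ A, mul_assoc _ B, ← hpa, ← hpb]
  apply mul_left_cancel₀ e2'.ne'
  calc nb * (‖c0 - b'‖ * la' * (P * E)) = (nb * (la' * P)) * (‖c0 - b'‖ * E) := by ring
    _ = (na * (lb' * Q)) * (‖c0 - b'‖ * E) := by rw [hR]
    _ = (na * ‖c0 - b'‖) * (lb' * Q * E) := by ring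
    _ = _ := by rw [hiso]; ring

theorem count_partition {C : Set (BerkP1 K)} (hCo : IsOpen C) (hC : IsPreconnected C) {e : K}
    (he : cl e ∈ C) (D : Finset (BerkP1 K)) (hD : ∀ b, b ∈ D ↔ b ∈ closure C \ C)
    (aa : BerkP1 K → K) (h1 : ∀ b ∈ D, cl (aa b) ∉ closure C)
    (h2 : ∀ b ∈ D, etp e (aa b) (rad C e (aa b)) = b) (s : Multiset K) :
    ∑ b ∈ D, s.countP (fun c => ¬ (‖c - e‖ < rad C e (aa b) * ‖c - aa b‖)) =
      s.countP (fun c => cl c ∉ C) := by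
  have hne : ∀ b ∈ D, e ≠ aa b := by
    rintro b hb h
    apply h1 b hb
    rw [← h]
    exact subset_closure he
  have hnc : ∀ c : K, cl c ∉ C → cl c ∉ closure C := by
    intro c hc hcc
    have hm := (hD _).2 ⟨hcc, hc⟩
    exact eta_nonclassical (hne _ hm) (rad_spec hCo hC he (h1 _ hm)).1 (c : OnePoint K) (h2 _ hm).symm
  have key : ∀ c : K, (∑ b ∈ D, if ¬ (‖c - e‖ < rad C e (aa b) * ‖c - aa b‖) then 1 else 0) =
      if cl c ∉ C then 1 else 0 := by
    intro c
    by_cases hc : cl c ∈ C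
    · rw [if_neg (not_not.2 hc)]
      apply Finset.sum_eq_zero
      intro b hb
      rw [if_neg]
      rw [not_not]
      have := rad_lt hCo hC he (h1 b hb) hc
      rw [bkN_cl, bkN_cl, mul_div_assoc', div_lt_div_iff_of_pos_right (max_one_pos _)] at this
      exact this
    · rw [if_pos hc]
      have hm := (hD _).2 (rad_mem_closure hCo hC he (hnc c hc))
      rw [Finset.sum_eq_single_of_mem _ hm]
      · rw [if_pos]
        rw [not_lt]
        refine exit_exists hCo hC he (hnc c hc) (hne _ hm) (rad_spec hCo hC he (h1 _ hm)).1 ?_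
        exact h2 _ hm
      · intro b hb hbne
        rw [if_neg]
        intro hlt
        apply hbne
        rw [not_lt] at hlt
        have hr := (rad_spec hCo hC he (h1 _ hb)).1
        have := exit_unique hCo hC he (hnc c hc) (hne b hb) hr
          (by rw [h2 b hb]; exact (hD b).1 hb) hlt
        rw [← this, h2 b hb]
  induction s using Multiset.induction_on with
  | empty => simp
  | cons c s ih =>
    rw [Multiset.countP_cons, ← ih, ← key c, ← Finset.sum_add_distrib]
    refine Finset.sum_congr rfl fun b hb => ?_
    rw [Multiset.countP_cons]

theorem countP_add_not (s : Multiset K) (p : K → Prop) :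
    s.countP p + s.countP (fun c => ¬ p c) = Multiset.card s := by
  have := Multiset.card_eq_countP_add_countP p s
  rw [this]

theorem caseA_surj (f : RatFunc K) (F : BerkP1 K → BerkP1 K) (hFc : Continuous F)
    (hFext : ∀ w : OnePoint K, F (iota K w) = iota K (evalP1 K f w))
    (hd : 1 < rdeg K f) {J : Set (BerkP1 K)} (hJ : IsClosed J) (hFJ : F ⁻¹' J = J)
    {z : BerkP1 K} (hz : z ∈ Jᶜ) {e a' : K} (he : cl e ∈ cc J z) (hea : F (cl e) = cl a')
    (ha : cl a' ≠ F OnePoint.infty)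
    (D : Finset (BerkP1 K)) (hD : ∀ b, b ∈ D ↔ b ∈ closure (cc J z) \ cc J z)
    (aa : BerkP1 K → K) (h1 : ∀ b ∈ D, cl (aa b) ∉ closure (cc J z))
    (h2 : ∀ b ∈ D, etp e (aa b) (rad (cc J z) e (aa b)) = b)
    {b' : K} (hb : cl b' ≠ F OnePoint.infty) (hbV : cl b' ∈ cc J (F z)) :
    cl b' ∈ F '' (cc J z) := by
  by_contra hcon
  have hCo := cc_open hJ z
  have hC := cc_pre J z
  have haV : cl a' ∈ cc J (F z) := hea ▸ cc_map hFc hFJ hz ⟨_, he, rfl⟩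
  have hne : ∀ b ∈ D, e ≠ aa b := by
    rintro b hb h
    apply h1 b hb
    rw [← h]
    exact subset_closure he
  have hab : a' ≠ b' := by
    rintro rfl
    exact hcon ⟨_, he, hea⟩
  have hloc : ∀ b ∈ D,
      (bG f a').roots.countP (fun c => ‖c - e‖ < rad (cc J z) e (aa b) * ‖c - aa b‖) =
      (bG f b').roots.countP (fun c => ‖c - e‖ < rad (cc J z) e (aa b) * ‖c - aa b‖) := by
    intro b hbD
    have hr := (rad_spec hCo hC he (h1 _ hbD)).1
    have hbJ : b ∈ J := by
      have h3 := (hD b).1 hbD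
      by_contra h4
      exact h3.2 (cc_closure hJ h3.1 h4)
    have hFb : F b ∈ J := by
      have : b ∈ F ⁻¹' J := by rw [hFJ]; exact hbJ
      exact this
    have n1 : F b ≠ cl a' := fun h => cc_sub J _ haV (h ▸ hFb)
    have n2 : F b ≠ cl b' := fun h => cc_sub J _ hbV (h ▸ hFb)
    apply count_local f F hFc hFext hd ha hb (hne b hbD) hr
    · rw [h2 b hbD]; exact n1
    · rw [h2 b hbD]; exact n2
    · rw [h2 b hbD]
      intro hbet
      have p1 := bkN_pos_of_ne n1
      have p2 := bkN_pos_of_ne n2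
      have ht : 0 < bkN (F b) a' / bkN (F b) b' := by positivity
      have heq : F b = etp a' b' (bkN (F b) a' / bkN (F b) b') := by
        apply eq_eta hab ht.le hbet
        rw [div_mul_cancel₀ _ p2.ne']
      have hmem := lemS (cc_pre J (F z)) hab ht haV hbV
        (by rw [bkN_cl_self]; exact mul_pos ht (bkN_cl_pos hab))
        (by rw [bkN_cl_self, mul_zero]; exact bkN_nonneg _ _)
      rw [← heq] at hmem
      exact cc_sub J _ hmem hFb
  have hloc' : ∀ b ∈ D,
      (bG f a').roots.countP (fun c => ¬ (‖c - e‖ < rad (cc J z) e (aa b) * ‖c - aa b‖)) =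
      (bG f b').roots.countP (fun c => ¬ (‖c - e‖ < rad (cc J z) e (aa b) * ‖c - aa b‖)) := by
    intro b hbD
    have g1 := countP_add_not (bG f a').roots
      (fun c => ‖c - e‖ < rad (cc J z) e (aa b) * ‖c - aa b‖)
    have g2 := countP_add_not (bG f b').roots
      (fun c => ‖c - e‖ < rad (cc J z) e (aa b) * ‖c - aa b‖)
    rw [bG_card_roots f F hFext hd _ ha] at g1
    rw [bG_card_roots f F hFext hd _ hb] at g2
    have := hloc b hbD
    omega
  have s1 := count_partition hCo hC he D hD aa h1 h2 (bG f a').roots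
  have s2 := count_partition hCo hC he D hD aa h1 h2 (bG f b').roots
  rw [Finset.sum_congr rfl hloc', s2] at s1
  have s3 : (bG f b').roots.countP (fun c => cl c ∉ cc J z) = Multiset.card (bG f b').roots := by
    rw [Multiset.countP_eq_card]
    intro c hc hcC
    exact hcon ⟨_, hcC, (mem_bG_roots f F hFext hd b' c).1 hc⟩
  rw [s3, bG_card_roots f F hFext hd _ hb, ← bG_card_roots f F hFext hd _ ha] at s1
  have s4 := Multiset.countP_eq_card.1 s1.symm e ((mem_bG_roots f F hFext hd a' e).2 hea)
  exact s4 he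

theorem caseA (f : RatFunc K) (F : BerkP1 K → BerkP1 K) (hFc : Continuous F)
    (hFext : ∀ w : OnePoint K, F (iota K w) = iota K (evalP1 K f w))
    (hd : 1 < rdeg K f) {J : Set (BerkP1 K)} (hJ : IsClosed J) (hFJ : F ⁻¹' J = J)
    {p : ℕ} (v : ℕ → BerkP1 K) (hv : ∀ i, v i ∈ Jᶜ)
    (hJeq : J = ⋃ j ∈ Finset.range p, frontier (cc J (v j)))
    {z : BerkP1 K} (hz : z ∈ Jᶜ) (hzne : ∀ i < p, cc J z ≠ cc J (v i)) :
    (frontier (cc J (F z))).Finite ∧ ∀ y ∈ frontier (cc J (F z)), ∀ w, iota K w ≠ y := by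
  have hCo := cc_open hJ z
  have hC := cc_pre J z
  obtain ⟨e, a', he, hea, ha⟩ := good_point f F hFext hd hCo ⟨z, cc_mem hz⟩
  have hex : ∀ i, ∃ a : K, cl a ∈ cc J (v i) := fun i =>
    cl_dense' (cc_open hJ _) ⟨_, cc_mem (hv i)⟩
  choose a haV using hex
  have hac : ∀ i < p, cl (a i) ∉ closure (cc J z) := fun i hi =>
    notMem_closure_of_disjoint (cc_open hJ _) (cc_disjoint (hzne i hi)) (haV i)
  have hfr : ∀ b, b ∈ closure (cc J z) \ cc J z → ∃ i < p, b = etp e (a i) (rad (cc J z) e (a i)) := by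
    intro b hb
    have hbJ : b ∈ J := by
      by_contra h4
      exact hb.2 (cc_closure hJ hb.1 h4)
    rw [hJeq] at hbJ
    simp only [Set.mem_iUnion, Finset.mem_range] at hbJ
    obtain ⟨i, hi, hbi⟩ := hbJ
    exact ⟨i, hi, pair_common hCo hC (cc_open hJ _) (cc_pre J _) (cc_disjoint (hzne i hi)) he
      (haV i) hb.1 (frontier_subset_closure hbi)⟩
  set D : Finset (BerkP1 K) := (Finset.range p).image
    fun i => etp e (a i) (rad (cc J z) e (a i)) with hDdef
  have hD : ∀ b, b ∈ D ↔ b ∈ closure (cc J z) \ cc J z := by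
    intro b
    rw [hDdef, Finset.mem_image]
    constructor
    · rintro ⟨i, hi, rfl⟩
      exact rad_mem_closure hCo hC he (hac i (Finset.mem_range.1 hi))
    · intro hb
      obtain ⟨i, hi, h⟩ := hfr b hb
      exact ⟨i, Finset.mem_range.2 hi, h.symm⟩
  have hch : ∀ b, ∃ c : K, b ∈ D → cl c ∉ closure (cc J z) ∧ etp e c (rad (cc J z) e c) = b := by
    intro b
    by_cases hb : b ∈ D
    · obtain ⟨i, hi, h⟩ := hfr b ((hD b).1 hb)
      exact ⟨a i, fun _ => ⟨hac i hi, h.symm⟩⟩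
    · exact ⟨0, fun h => absurd h hb⟩
  choose aa haa using hch
  have hsurj : ∀ b' : K, cl b' ≠ F OnePoint.infty → cl b' ∈ cc J (F z) → cl b' ∈ F '' (cc J z) :=
    fun b' h3 h4 => caseA_surj f F hFc hFext hd hJ hFJ hz he hea ha D hD aa
      (fun b hb => (haa b hb).1) (fun b hb => (haa b hb).2) h3 h4
  have hclosed : IsClosed (F '' closure (cc J z)) :=
    (isClosed_closure.isCompact.image hFc).isClosed
  have hVsub : cc J (F z) ⊆ F '' closure (cc J z) := by
    by_contra hns
    obtain ⟨w, hw1, hw2⟩ := Set.not_subset.1 hns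
    have hfin : {b' : K | cl b' = F OnePoint.infty}.Finite := by
      apply Set.Subsingleton.finite
      intro b1 hb1 b2 hb2
      have e1 : cl b1 = F OnePoint.infty := hb1
      have e2 : cl b2 = F OnePoint.infty := hb2
      exact cl_injective (e1.trans e2.symm)
    obtain ⟨b', hb1, hb2⟩ := cl_dense ((cc_open hJ (F z)).inter hclosed.isOpen_compl) ⟨w, hw1, hw2⟩ _ hfin
    exact hb1.2 (Set.image_mono subset_closure (hsurj b' hb2 hb1.1))
  have hsub : frontier (cc J (F z)) ⊆ F '' (D : Set (BerkP1 K)) := by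
    rw [cc_frontier hJ]
    rintro y ⟨hy1, hy2⟩
    obtain ⟨c, hc, rfl⟩ := closure_minimal hVsub hclosed hy1
    have hcJ : c ∈ J := by rw [← hFJ]; exact hy2
    exact ⟨c, Finset.mem_coe.2 ((hD c).2 ⟨hc, fun h => cc_sub J _ h hcJ⟩), rfl⟩
  refine ⟨(D.finite_toSet.image F).subset hsub, ?_⟩
  intro y hy w hw
  obtain ⟨b, hb, rfl⟩ := hsub hy
  have hb' : b ∈ D := hb
  obtain ⟨w', hw'⟩ := F_nonclassical f F hFc hFext hd b w hw.symm
  have h5 := haa b hb'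
  refine eta_nonclassical ?_ (rad_spec hCo hC he h5.1).1 w' (hw'.trans h5.2.symm)
  intro h6
  apply h5.1
  rw [← h6]
  exact subset_closure he

end BerkCaseAMain


section BerkCaseB

variable {K}

set_option linter.unusedSectionVars false
set_option linter.unusedVariables false

theorem pl_le (x : BerkP1 K) (a b c : K) :
    ‖a - b‖ * bkN x c ≤ max (bkN x a * ‖c - b‖) (bkN x b * ‖c - a‖) := by
  have := bkN_pl x c a b
  rwa [mul_comm ‖c - b‖, mul_comm ‖c - a‖] at this

theorem pl_eq {a b c : K} {x : BerkP1 K} (h : bkN x a * ‖c - b‖ < bkN x b * ‖c - a‖) :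
    ‖a - b‖ * bkN x c = bkN x b * ‖c - a‖ := by
  apply le_antisymm
  · have := pl_le x a b c
    rwa [max_eq_right h.le] at this
  · have h1 := bkN_pl x b c a
    rw [norm_sub_rev b a, norm_sub_rev b c, mul_comm ‖c - a‖, mul_comm ‖c - b‖] at h1
    rcases le_max_iff.1 h1 with h2 | h2
    · exact h2
    · exact absurd h2 (not_le.2 h)

theorem exists_theta_roots {a1 a2 : K} {r : ℝ} (hr : 0 < r) (s : Multiset K)
    (hs : ∀ c ∈ s, ‖c - a1‖ < r * ‖c - a2‖) :
    ∃ θ, 0 ≤ θ ∧ θ < r ∧ ∀ c ∈ s, ‖c - a1‖ ≤ θ * ‖c - a2‖ := by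
  induction s using Multiset.induction_on with
  | empty => exact ⟨0, le_rfl, hr, by simp⟩
  | cons c s ih =>
    obtain ⟨θ, h0, h1, h2⟩ := ih fun c hc => hs c (Multiset.mem_cons_of_mem hc)
    have hc := hs c (Multiset.mem_cons_self c s)
    have hp : 0 < ‖c - a2‖ := by
      by_contra h
      have h' : ‖c - a2‖ = 0 := le_antisymm (not_lt.1 h) (norm_nonneg _)
      rw [h', mul_zero] at hc
      exact absurd hc (not_lt.2 (norm_nonneg _))
    refine ⟨max θ (‖c - a1‖ / ‖c - a2‖), h0.trans (le_max_left _ _), ?_, ?_⟩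
    · rw [max_lt_iff]
      refine ⟨h1, ?_⟩
      rwa [div_lt_iff₀ hp]
    · intro b hb
      rcases Multiset.mem_cons.1 hb with rfl | hb
      · rw [← div_le_iff₀ hp]
        exact le_max_right _ _
      · exact (h2 b hb).trans (mul_le_mul_of_nonneg_right (le_max_left _ _) (norm_nonneg _))

theorem prod_map_mul_const (s : Multiset K) (g : K → ℝ) (k : ℝ) :
    (s.map fun c => k * g c).prod = k ^ (Multiset.card s) * (s.map g).prod := by
  rw [Multiset.prod_map_mul]
  simp

theorem prod_map_pos (s : Multiset K) (g : K → ℝ) (h : ∀ c ∈ s, 0 < g c) : 0 < (s.map g).prod := by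
  induction s using Multiset.induction_on with
  | empty => simp
  | cons c s ih =>
    rw [Multiset.map_cons, Multiset.prod_cons]
    exact mul_pos (h c (Multiset.mem_cons_self c s)) (ih fun c hc => h c (Multiset.mem_cons_of_mem hc))

theorem ratio_map (f : RatFunc K) (F : BerkP1 K → BerkP1 K) (hFc : Continuous F)
    (hFext : ∀ w : OnePoint K, F (iota K w) = iota K (evalP1 K f w))
    (hd : 1 < rdeg K f) {b1 b2 : K} (hb1 : cl b1 ≠ F OnePoint.infty)
    (hb2 : cl b2 ≠ F OnePoint.infty) {a1 a2 : K} (ha : a1 ≠ a2) {r : ℝ} (hr : 0 < r)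
    (hα : ∀ c, F (cl c) = cl b1 → ‖c - a1‖ < r * ‖c - a2‖)
    (hβ : ∀ c, F (cl c) = cl b2 → r * ‖c - a2‖ < ‖c - a1‖) :
    ∃ κ θ : ℝ, 0 < κ ∧ 0 ≤ θ ∧ θ < r ∧ ∀ x u, 0 ≤ u → u ≤ r → bkN x a1 = u * bkN x a2 →
      bkN (F x) b1 ≤ κ * (max u θ) ^ rdeg K f * bkN (F x) b2 ∧
      (θ < u → bkN (F x) b1 = κ * u ^ rdeg K f * bkN (F x) b2) := by
  have hα' : ∀ c ∈ (bG f b1).roots, ‖c - a1‖ < r * ‖c - a2‖ :=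
    fun c hc => hα c ((mem_bG_roots f F hFext hd b1 c).1 hc)
  have hβ' : ∀ c ∈ (bG f b2).roots, r * ‖c - a2‖ < ‖c - a1‖ :=
    fun c hc => hβ c ((mem_bG_roots f F hFext hd b2 c).1 hc)
  obtain ⟨θ, hθ0, hθ1, hθ⟩ := exists_theta_roots hr _ hα'
  have la : 0 < ‖(bG f b1).leadingCoeff‖ :=
    norm_pos_iff.2 (leadingCoeff_ne_zero.2 (bG_ne_zero f hd b1))
  have lb : 0 < ‖(bG f b2).leadingCoeff‖ :=
    norm_pos_iff.2 (leadingCoeff_ne_zero.2 (bG_ne_zero f hd b2))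
  have pα : ∀ c ∈ (bG f b1).roots, 0 < ‖c - a2‖ := by
    intro c hc
    have h1 := (norm_nonneg _).trans_lt (hα' c hc)
    exact (pos_iff_pos_of_mul_pos h1).1 hr
  have pβ : ∀ c ∈ (bG f b2).roots, 0 < ‖c - a1‖ := by
    intro c hc
    exact (mul_nonneg hr.le (norm_nonneg _)).trans_lt (hβ' c hc)
  have PA := prod_map_pos _ (fun c => ‖c - a2‖) pα
  have PB := prod_map_pos _ (fun c => ‖c - a1‖) pβ
  set A := ((bG f b1).roots.map fun c => ‖c - a2‖).prod with hA
  set B := ((bG f b2).roots.map fun c => ‖c - a1‖).prod with hB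
  set L1 := ‖(bG f b1).leadingCoeff‖ with hL1
  set L2 := ‖(bG f b2).leadingCoeff‖ with hL2
  refine ⟨L1 * A / (L2 * B), θ, by positivity, hθ0, hθ1, ?_⟩
  intro x u hu0 hur hxu
  have hn2 : 0 < bkN x a2 := by
    by_contra h
    have h' : bkN x a2 = 0 := le_antisymm (not_lt.1 h) (bkN_nonneg _ _)
    have h'' : 0 < bkN x a1 := bkN_pos_or x ha.symm h'
    rw [hxu, h', mul_zero] at h''
    exact lt_irrefl _ h''
  have hδ : 0 < ‖a1 - a2‖ := nsub_pos ha
  have hR := F_ratio f F hFc hFext hd b1 b2 hb1 hb2 x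
  have c1 := bG_card_roots f F hFext hd _ hb1
  have c2 := bG_card_roots f F hFext hd _ hb2
  set P := ((bG f b1).roots.map (bkN x)).prod with hP
  set Q := ((bG f b2).roots.map (bkN x)).prod with hQ
  have hQ' : ‖a1 - a2‖ ^ rdeg K f * Q = bkN x a2 ^ rdeg K f * B := by
    have e1 := prod_map_mul_const (bG f b2).roots (bkN x) ‖a1 - a2‖
    have e2 := prod_map_mul_const (bG f b2).roots (fun c => ‖c - a1‖) (bkN x a2)
    rw [c2] at e1 e2
    rw [hQ, hB, ← e1, ← e2]
    congr 1
    apply Multiset.map_congr rfl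
    intro c hc
    apply pl_eq
    rw [hxu]
    have := hβ' c hc
    calc u * bkN x a2 * ‖c - a2‖ = bkN x a2 * (u * ‖c - a2‖) := by ring
      _ ≤ bkN x a2 * (r * ‖c - a2‖) := by gcongr
      _ < bkN x a2 * ‖c - a1‖ := by gcongr
  have e1 := prod_map_mul_const (bG f b1).roots (bkN x) ‖a1 - a2‖
  have e2 : ∀ m, _ := prod_map_mul_const (bG f b1).roots (fun c => ‖c - a2‖)
  rw [c1] at e1 e2
  have fin : ∀ T : ℝ, bkN (F x) b1 * (L2 * B) * (bkN x a2 ^ rdeg K f) =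
      bkN (F x) b2 * L1 * (‖a1 - a2‖ ^ rdeg K f * P) := by
    intro T
    calc _ = bkN (F x) b1 * L2 * (bkN x a2 ^ rdeg K f * B) := by ring
      _ = (bkN (F x) b1 * (L2 * Q)) * ‖a1 - a2‖ ^ rdeg K f := by rw [← hQ']; ring
      _ = _ := by rw [hR]; ring
  have fin := fin 0
  have hNd : 0 < bkN x a2 ^ rdeg K f := by positivity
  have hLB : 0 < L2 * B := by positivity
  constructor
  · have hP' : ‖a1 - a2‖ ^ rdeg K f * P ≤ (bkN x a2 * max u θ) ^ rdeg K f * A := by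
      rw [hP, hA, ← e1, ← e2]
      apply Multiset.prod_map_le_prod_map₀
      · intro c hc
        exact mul_nonneg (norm_nonneg _) (bkN_nonneg _ _)
      · intro c hc
        refine (pl_le x a1 a2 c).trans (max_le ?_ ?_)
        · rw [hxu, mul_comm u]
          gcongr
          exact le_max_left _ _
        · rw [mul_assoc]
          refine mul_le_mul_of_nonneg_left ((hθ c hc).trans ?_) hn2.le
          gcongr
          exact le_max_right _ _
    have h3 : bkN (F x) b1 * (L2 * B) * (bkN x a2 ^ rdeg K f) ≤
        bkN (F x) b2 * L1 * ((bkN x a2 * max u θ) ^ rdeg K f * A) := by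
      rw [fin]
      exact mul_le_mul_of_nonneg_left hP' (mul_nonneg (bkN_nonneg _ _) la.le)
    have h4 : (bkN (F x) b1 * (L2 * B)) * (bkN x a2 ^ rdeg K f) ≤
        (bkN (F x) b2 * L1 * (max u θ ^ rdeg K f * A)) * (bkN x a2 ^ rdeg K f) := by
      rw [mul_pow] at h3
      linarith
    have h5 := le_of_mul_le_mul_right h4 hNd
    have h6 : bkN (F x) b1 ≤ (bkN (F x) b2 * L1 * (max u θ ^ rdeg K f * A)) / (L2 * B) := by
      rwa [le_div_iff₀ hLB]
    refine h6.trans (le_of_eq ?_)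
    ring
  · intro hu
    have hP' : ‖a1 - a2‖ ^ rdeg K f * P = (bkN x a2 * u) ^ rdeg K f * A := by
      rw [hP, hA, ← e1, ← e2]
      congr 1
      apply Multiset.map_congr rfl
      intro c hc
      have h7 : bkN x a2 * ‖c - a1‖ < bkN x a1 * ‖c - a2‖ := by
        rw [hxu, mul_comm u, mul_assoc]
        refine mul_lt_mul_of_pos_left ((hθ c hc).trans_lt ?_) hn2
        exact mul_lt_mul_of_pos_right hu (pα c hc)
      have h8 := pl_eq h7
      rw [norm_sub_rev a1 a2, h8, hxu, mul_comm u]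
    rw [hP', mul_pow] at fin
    have h4 : (bkN (F x) b1 * (L2 * B)) * (bkN x a2 ^ rdeg K f) =
        (bkN (F x) b2 * L1 * (u ^ rdeg K f * A)) * (bkN x a2 ^ rdeg K f) := by
      linarith
    have h5 := mul_right_cancel₀ hNd.ne' h4
    have h6 : bkN (F x) b1 = (bkN (F x) b2 * L1 * (u ^ rdeg K f * A)) / (L2 * B) := by
      rw [eq_div_iff hLB.ne', h5]
    rw [h6]
    ring

/-- The map on exit radii between two components and their images. -/
theorem pair_map (f : RatFunc K) (F : BerkP1 K → BerkP1 K) (hFc : Continuous F)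
    (hFext : ∀ w : OnePoint K, F (iota K w) = iota K (evalP1 K f w))
    (hd : 1 < rdeg K f) {C1 C2 E1 E2 : Set (BerkP1 K)} (oC1 : IsOpen C1) (oC2 : IsOpen C2)
    (oE1 : IsOpen E1) (oE2 : IsOpen E2) (cC1 : IsPreconnected C1) (cC2 : IsPreconnected C2)
    (cE1 : IsPreconnected E1) (cE2 : IsPreconnected E2) (hC : Disjoint C1 C2)
    (hE : Disjoint E1 E2) (h1 : F ⁻¹' E1 = C1) (h2 : F ⁻¹' E2 = C2)
    {a1 a2 b1 b2 : K} (ha1 : cl a1 ∈ C1) (ha2 : cl a2 ∈ C2) (hb1 : cl b1 ∈ E1) (hb2 : cl b2 ∈ E2)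
    (hb1' : cl b1 ≠ F OnePoint.infty) (hb2' : cl b2 ≠ F OnePoint.infty) :
    ∃ τ : ℝ, 0 ≤ τ ∧ τ < 1 ∧ ∀ x, bkN x a1 < rad C1 a1 a2 * bkN x a2 →
      bkN (F x) b1 ≤ (max (bkN x a1 / (rad C1 a1 a2 * bkN x a2)) τ) ^ rdeg K f *
        (rad E1 b1 b2 * bkN (F x) b2) := by
  have ha2' := notMem_closure_of_disjoint oC2 hC ha2
  have ha1' := notMem_closure_of_disjoint oC1 hC.symm ha1
  have hb2c := notMem_closure_of_disjoint oE2 hE hb2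
  have ha : a1 ≠ a2 := by
    rintro rfl
    exact ha2' (subset_closure ha1)
  have hb : b1 ≠ b2 := by
    rintro rfl
    exact hb2c (subset_closure hb1)
  have hr := (rad_spec oC1 cC1 ha1 ha2').1
  have hq := (rad_spec oC2 cC2 ha2 ha1').1
  have hr' := (rad_spec oE1 cE1 hb1 hb2c).1
  have hrq := pair_rad_le oC1 cC1 oC2 cC2 hC ha1 ha2
  set r := rad C1 a1 a2 with hrdef
  set q := rad C2 a2 a1 with hqdef
  set r' := rad E1 b1 b2 with hr'def
  have hα : ∀ c, F (cl c) = cl b1 → ‖c - a1‖ < r * ‖c - a2‖ := by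
    intro c hc
    have hm : cl c ∈ C1 := by
      rw [← h1, Set.mem_preimage, hc]; exact hb1
    have := rad_lt oC1 cC1 ha1 ha2' hm
    rwa [bkN_cl, bkN_cl, mul_div_assoc', div_lt_div_iff_of_pos_right (max_one_pos _)] at this
  have hβ : ∀ c, F (cl c) = cl b2 → r * ‖c - a2‖ < ‖c - a1‖ := by
    intro c hc
    have hm : cl c ∈ C2 := by
      rw [← h2, Set.mem_preimage, hc]; exact hb2
    have := rad_lt oC2 cC2 ha2 ha1' hm
    rw [bkN_cl, bkN_cl, mul_div_assoc', div_lt_div_iff_of_pos_right (max_one_pos _)] at this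
    calc r * ‖c - a2‖ < r * (q * ‖c - a1‖) := by gcongr
      _ = (r * q) * ‖c - a1‖ := by ring
      _ ≤ 1 * ‖c - a1‖ := by gcongr
      _ = _ := one_mul _
  obtain ⟨κ, θ, hκ, hθ0, hθ1, hmain⟩ := ratio_map f F hFc hFext hd hb1' hb2' ha hr hα hβ
  have hd0 : rdeg K f ≠ 0 := by omega
  -- the exit point shows `κ r^d ≤ r'`
  have hle : κ * r ^ rdeg K f ≤ r' := by
    have hm := (rad_mem_closure oC1 cC1 ha1 ha2').1
    have hFm : F (etp a1 a2 r) ∈ closure E1 := by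
      have : F '' C1 ⊆ E1 := by rw [← h1]; exact Set.image_preimage_subset _ _
      exact closure_mono this (image_closure_subset_closure_image hFc ⟨_, hm, rfl⟩)
    have e1 := rad_le oE1 cE1 hb1 hb2c hFm
    have e2 := (hmain _ r hr.le le_rfl (eta_ratio a1 a2 hr.le)).2 hθ1
    have hp : 0 < bkN (F (etp a1 a2 r)) b2 := by
      by_contra h
      have h' : bkN (F (etp a1 a2 r)) b2 = 0 := le_antisymm (not_lt.1 h) (bkN_nonneg _ _)
      have h'' := bkN_pos_or _ hb.symm h'
      rw [e2, h', mul_zero] at h''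
      exact lt_irrefl _ h''
    rw [e2] at e1
    exact le_of_mul_le_mul_right e1 hp
  refine ⟨θ / r, by positivity, (div_lt_one hr).2 hθ1, ?_⟩
  intro x hx
  have hn2 : 0 < bkN x a2 := by
    by_contra h
    have h' : bkN x a2 = 0 := le_antisymm (not_lt.1 h) (bkN_nonneg _ _)
    rw [h', mul_zero] at hx
    exact absurd hx (not_lt.2 (bkN_nonneg _ _))
  have hu0 : 0 ≤ bkN x a1 / bkN x a2 := div_nonneg (bkN_nonneg _ _) hn2.le
  have hur : bkN x a1 / bkN x a2 ≤ r := by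
    rw [div_le_iff₀ hn2]; exact hx.le
  have h3 := (hmain x _ hu0 hur (by rw [div_mul_cancel₀ _ hn2.ne'])).1
  have h4 : max (bkN x a1 / (r * bkN x a2)) (θ / r) = max (bkN x a1 / bkN x a2) θ / r := by
    rw [← max_div_div_right hr.le]
    congr 1
    rw [div_div, mul_comm r]
  rw [h4, div_pow]
  have h5 : 0 ≤ max (bkN x a1 / bkN x a2) θ := hu0.trans (le_max_left _ _)
  calc bkN (F x) b1 ≤ κ * max (bkN x a1 / bkN x a2) θ ^ rdeg K f * bkN (F x) b2 := h3
    _ = max (bkN x a1 / bkN x a2) θ ^ rdeg K f / r ^ rdeg K f *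
      ((κ * r ^ rdeg K f) * bkN (F x) b2) := by
        field_simp
    _ ≤ _ := by
        have := bkN_nonneg (F x) b2
        gcongr

end BerkCaseB


section BerkCaseBNull

variable {K}

set_option linter.unusedSectionVars false
set_option linter.unusedVariables false

/-- Truncated logarithmic-type potential used as a Lyapunov function. -/
noncomputable def psi (r : ℝ) (a1 a2 : K) (τ : ℝ) (x : BerkP1 K) : ℝ :=
  if bkN x a1 < r * bkN x a2 then max (bkN x a1 / (r * bkN x a2)) τ else 1

theorem psi_le_one (r : ℝ) (a1 a2 : K) {τ : ℝ} (hτ : τ ≤ 1) (x : BerkP1 K) :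
    psi r a1 a2 τ x ≤ 1 := by
  unfold psi
  split_ifs with h
  · refine max_le ?_ hτ
    apply div_le_one_of_le₀ h.le
    exact (bkN_nonneg _ _).trans h.le
  · exact le_rfl

theorem psi_nonneg (r : ℝ) (a1 a2 : K) {τ : ℝ} (hτ : 0 ≤ τ) (x : BerkP1 K) :
    0 ≤ psi r a1 a2 τ x := by
  unfold psi
  split_ifs with h
  · exact hτ.trans (le_max_right _ _)
  · exact zero_le_one

theorem psi_measurable (r : ℝ) (a1 a2 : K) (τ : ℝ) : Measurable (psi r a1 a2 τ) := by
  unfold psi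
  have m1 : Measurable fun x : BerkP1 K => bkN x a1 := (bkN_continuous a1).measurable
  have m2 : Measurable fun x : BerkP1 K => r * bkN x a2 :=
    (continuous_const.mul (bkN_continuous a2)).measurable
  exact Measurable.ite (measurableSet_lt m1 m2) ((m1.div m2).max measurable_const) measurable_const

theorem psi_integrable (μ : Measure (BerkP1 K)) [IsProbabilityMeasure μ] (r : ℝ) (a1 a2 : K)
    {τ : ℝ} (hτ0 : 0 ≤ τ) (hτ : τ ≤ 1) (g : BerkP1 K → BerkP1 K) (hg : Measurable g) :
    Integrable (fun x => psi r a1 a2 τ (g x)) μ := by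
  refine Integrable.of_bound ((psi_measurable r a1 a2 τ).comp hg).aestronglyMeasurable 1 ?_
  refine Eventually.of_forall fun x => ?_
  rw [Real.norm_eq_abs, abs_of_nonneg (psi_nonneg r a1 a2 hτ0 _)]
  exact psi_le_one r a1 a2 hτ _

theorem psi_step {d : ℕ} (hd : 1 < d) {F : BerkP1 K → BerkP1 K} {a1 a2 b1 b2 : K} (hb : b1 ≠ b2)
    {r r' τ0 : ℝ} (hr' : 0 < r')
    (hm : ∀ x, bkN x a1 < r * bkN x a2 →
      bkN (F x) b1 ≤ (max (bkN x a1 / (r * bkN x a2)) τ0) ^ d * (r' * bkN (F x) b2))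
    {τ : ℝ} (h0 : 0 ≤ τ0) (h1 : τ0 ≤ τ) (h2 : τ < 1) (x : BerkP1 K) :
    psi r' b1 b2 τ (F x) ≤ psi r a1 a2 τ x ∧
    (τ * (r * bkN x a2) < bkN x a1 → bkN x a1 < r * bkN x a2 →
      psi r' b1 b2 τ (F x) < psi r a1 a2 τ x) := by
  by_cases hx : bkN x a1 < r * bkN x a2
  · have hx0 : 0 < r * bkN x a2 := (bkN_nonneg _ _).trans_lt hx
    have hu0 : 0 ≤ bkN x a1 / (r * bkN x a2) := div_nonneg (bkN_nonneg _ _) hx0.le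
    have e1 : psi r a1 a2 τ x = max (bkN x a1 / (r * bkN x a2)) τ := by
      unfold psi; rw [if_pos hx]
    have hm1 : max (bkN x a1 / (r * bkN x a2)) τ < 1 := max_lt ((div_lt_one hx0).2 hx) h2
    have hm0 : 0 ≤ max (bkN x a1 / (r * bkN x a2)) τ := hu0.trans (le_max_left _ _)
    have hle : bkN (F x) b1 ≤ (max (bkN x a1 / (r * bkN x a2)) τ) ^ d * (r' * bkN (F x) b2) := by
      refine (hm x hx).trans ?_
      have := bkN_nonneg (F x) b2
      gcongr
    have hp : 0 < bkN (F x) b2 := by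
      by_contra h
      have h' : bkN (F x) b2 = 0 := le_antisymm (not_lt.1 h) (bkN_nonneg _ _)
      have h'' := bkN_pos_or _ hb.symm h'
      rw [h', mul_zero, mul_zero] at hle
      exact absurd h'' (not_lt.2 hle)
    set m := max (bkN x a1 / (r * bkN x a2)) τ with hmdef
    have hrp : 0 < r' * bkN (F x) b2 := by positivity
    have hmd : m ^ d < 1 := pow_lt_one₀ hm0 hm1 (by omega)
    have hlt : bkN (F x) b1 < r' * bkN (F x) b2 := by
      refine hle.trans_lt ?_
      calc m ^ d * (r' * bkN (F x) b2) < 1 * (r' * bkN (F x) b2) := by gcongr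
        _ = _ := one_mul _
    have e2 : psi r' b1 b2 τ (F x) = max (bkN (F x) b1 / (r' * bkN (F x) b2)) τ := by
      unfold psi; rw [if_pos hlt]
    have h3 : bkN (F x) b1 / (r' * bkN (F x) b2) ≤ m ^ d := by
      rwa [div_le_iff₀ hrp]
    rw [e1, e2]
    constructor
    · refine max_le (h3.trans ?_) (le_max_right _ _)
      exact pow_le_of_le_one hm0 hm1.le (by omega)
    · intro h4 _
      have h5 : τ < m := lt_of_lt_of_le ((lt_div_iff₀ hx0).2 h4) (le_max_left _ _)
      refine max_lt (h3.trans_lt ?_) h5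
      have hmp : 0 < m := (h0.trans h1).trans_lt h5
      calc m ^ d < m ^ 1 := pow_lt_pow_right_of_lt_one₀ hmp hm1 hd
        _ = m := pow_one m
  · constructor
    · have : psi r a1 a2 τ x = 1 := by unfold psi; rw [if_neg hx]
      rw [this]
      exact psi_le_one _ _ _ h2.le _
    · intro _ h; exact absurd h hx

theorem exists_uniform (p : ℕ) (t : ℕ → ℝ) (ht : ∀ k, 0 ≤ t k ∧ t k < 1) :
    ∃ τ, 0 ≤ τ ∧ τ < 1 ∧ ∀ k < p, t k ≤ τ := by
  induction p with
  | zero => exact ⟨0, le_rfl, one_pos, by simp⟩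
  | succ p ih =>
    obtain ⟨τ, h0, h1, h2⟩ := ih
    refine ⟨max τ (t p), h0.trans (le_max_left _ _), max_lt h1 (ht p).2, ?_⟩
    intro k hk
    rcases Nat.lt_succ_iff_lt_or_eq.1 hk with h | rfl
    · exact (h2 k h).trans (le_max_left _ _)
    · exact le_max_right _ _

/-- A periodic chain of Lyapunov inequalities forces a null annulus. -/
theorem annulus_null {d : ℕ} (hd : 1 < d) (F : BerkP1 K → BerkP1 K) (hFc : Continuous F)
    (μ : Measure (BerkP1 K)) [IsProbabilityMeasure μ]
    (hinv : ∀ A : Set (BerkP1 K), MeasurableSet A → μ (F ⁻¹' A) = μ A)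
    (p : ℕ) (hp : 0 < p) (a b : ℕ → K) (r : ℕ → ℝ) (hab : ∀ k, a k ≠ b k) (hr : ∀ k, 0 < r k)
    (hpa : a p = a 0) (hpb : b p = b 0) (hpr : r p = r 0)
    (hstep : ∀ k, ∃ τ : ℝ, 0 ≤ τ ∧ τ < 1 ∧ ∀ x, bkN x (a k) < r k * bkN x (b k) →
      bkN (F x) (a (k + 1)) ≤ (max (bkN x (a k) / (r k * bkN x (b k))) τ) ^ d *
        (r (k + 1) * bkN (F x) (b (k + 1)))) :
    ∃ τ : ℝ, 0 ≤ τ ∧ τ < 1 ∧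
      μ {x | τ * (r 0 * bkN x (b 0)) < bkN x (a 0) ∧ bkN x (a 0) < r 0 * bkN x (b 0)} = 0 := by
  choose t ht0 ht1 ht using hstep
  obtain ⟨τ, h0, h1, h2⟩ := exists_uniform p t fun k => ⟨ht0 k, ht1 k⟩
  refine ⟨τ, h0, h1, ?_⟩
  have hFm : Measurable F := hFc.measurable
  have hmap : Measure.map F μ = μ := by
    ext A hA
    rw [Measure.map_apply hFm hA, hinv A hA]
  set φ : ℕ → BerkP1 K → ℝ := fun k => psi (r k) (a k) (b k) τ with hφ
  have hstep' : ∀ k < p, ∀ x, _ := fun k hk x =>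
    psi_step hd (hab (k + 1)) (hr (k + 1)) (ht k) (ht0 k) (h2 k hk) h1 x
  have hint : ∀ k, ∫ x, φ k (F x) ∂μ = ∫ x, φ k x ∂μ := by
    intro k
    conv_rhs => rw [← hmap]
    rw [integral_map hFm.aemeasurable (psi_measurable _ _ _ _).aestronglyMeasurable]
  have i1 : ∀ k, Integrable (φ k) μ := fun k =>
    psi_integrable μ (r k) (a k) (b k) h0 h1.le id measurable_id
  have i2 : ∀ k, Integrable (fun x => φ k (F x)) μ := fun k =>
    psi_integrable μ (r k) (a k) (b k) h0 h1.le F hFm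
  have hdec : ∀ k < p, ∫ x, φ (k + 1) x ∂μ ≤ ∫ x, φ k x ∂μ := by
    intro k hk
    rw [← hint (k + 1)]
    exact integral_mono (i2 _) (i1 _) fun x => (hstep' k hk x).1
  have hdec' : ∀ k, k + 1 ≤ p → ∫ x, φ (k + 1) x ∂μ ≤ ∫ x, φ 1 x ∂μ := by
    intro k
    induction k with
    | zero => intro _; exact le_rfl
    | succ k ih => intro hk; exact (hdec (k + 1) (by omega)).trans (ih (by omega))
  have hφp : φ p = φ 0 := by
    simp only [hφ]
    rw [hpa, hpb, hpr]
  have hge : ∫ x, φ 0 x ∂μ ≤ ∫ x, φ 1 x ∂μ := by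
    have := hdec' (p - 1) (by omega)
    rw [Nat.sub_add_cancel hp, hφp] at this
    exact this
  have hz : ∫ x, (φ 0 x - φ 1 (F x)) ∂μ = 0 := by
    rw [integral_sub (i1 0) (i2 1), hint 1]
    have := hdec 0 hp
    rw [zero_add] at this
    linarith
  have hnn : 0 ≤ fun x => φ 0 x - φ 1 (F x) := fun x => sub_nonneg.2 (hstep' 0 hp x).1
  rw [integral_eq_zero_iff_of_nonneg hnn ((i1 0).sub (i2 1))] at hz
  have hae : ∀ᵐ x ∂μ, ¬ (τ * (r 0 * bkN x (b 0)) < bkN x (a 0) ∧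
      bkN x (a 0) < r 0 * bkN x (b 0)) := by
    filter_upwards [hz] with x hx hcon
    have h3 := (hstep' 0 hp x).2 hcon.1 hcon.2
    have h4 : φ 0 x - φ 1 (F x) = 0 := hx
    have h5 : φ 1 (F x) < φ 0 x := h3
    linarith
  rw [ae_iff] at hae
  simpa only [not_not] using hae

end BerkCaseBNull


section BerkCaseBMain

variable {K}

set_option linter.unusedSectionVars false
set_option linter.unusedVariables false

theorem caseB (f : RatFunc K) (F : BerkP1 K → BerkP1 K) (hFc : Continuous F)
    (hFext : ∀ w : OnePoint K, F (iota K w) = iota K (evalP1 K f w))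
    (hd : 1 < rdeg K f) (μ : Measure (BerkP1 K)) [IsProbabilityMeasure μ] [μ.Regular]
    (hinv : ∀ A : Set (BerkP1 K), MeasurableSet A → μ (F ⁻¹' A) = μ A)
    (hatom : ∀ S : BerkP1 K, (∀ a : OnePoint K, iota K a ≠ S) → μ {S} = 0)
    {J : Set (BerkP1 K)} (hJs : J = msupport K μ) (hJ : IsClosed J) (hFJ : F ⁻¹' J = J)
    {x : BerkP1 K} (hx : x ∈ Jᶜ) {p : ℕ} (hp : 0 < p)
    (hper : ∀ j, cc J (F^[j + p] x) = cc J (F^[j] x))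
    (hJeq : J = ⋃ j ∈ Finset.range p, frontier (cc J (F^[j] x)))
    (hback : ∀ z ∈ Jᶜ, ∀ j, cc J (F z) = cc J (F^[j] x) → ∃ i, cc J z = cc J (F^[i] x))
    {j0 : ℕ} (hj0 : cc J (F^[j0] x) ≠ cc J (F^[0] x)) : False := by
  set W : ℕ → Set (BerkP1 K) := fun j => cc J (F^[j] x) with hWdef
  have hwJ : ∀ j, F^[j] x ∈ Jᶜ := fun j => notMem_iter hFJ hx j
  have hWo : ∀ j, IsOpen (W j) := fun j => cc_open hJ _
  have hWc : ∀ j, IsPreconnected (W j) := fun j => cc_pre J _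
  have hperk : ∀ k j, W (j + k * p) = W j := by
    intro k
    induction k with
    | zero => intro j; simp
    | succ k ih =>
      intro j
      have : j + (k + 1) * p = (j + k * p) + p := by ring
      rw [this]
      exact (hper _).trans (ih j)
  have hinj : ∀ k l m, W (l + k) = W (m + k) → W l = W m := by
    intro k l m h
    have h1 := cc_iter_eq hFc hFJ (hwJ (l + k)) (hwJ (m + k)) h (k * p - k)
    rw [← Function.iterate_add_apply, ← Function.iterate_add_apply] at h1
    have hk : k ≤ k * p := Nat.le_mul_of_pos_right k hp
    have e1 : k * p - k + (l + k) = l + k * p := by omega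
    have e2 : k * p - k + (m + k) = m + k * p := by omega
    rw [e1, e2] at h1
    have h2 : W (l + k * p) = W (m + k * p) := h1
    rwa [hperk, hperk] at h2
  have hpre : ∀ j, F ⁻¹' (W (j + 1)) = W j := by
    intro j
    ext z
    constructor
    · intro hz
      have hz' : F z ∈ W (j + 1) := hz
      have hzJ : z ∈ Jᶜ := by
        intro h
        have h1 : z ∈ F ⁻¹' J := by rw [hFJ]; exact h
        exact cc_sub J _ hz' h1
      have e1 : cc J (F z) = cc J (F^[j + 1] x) := (cc_eq hz').symm
      obtain ⟨i, hi⟩ := hback z hzJ _ e1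
      have e2 : cc J (F z) = cc J (F^[i + 1] x) := by
        rw [Function.iterate_succ_apply']
        exact cc_map_eq' hFc hFJ hzJ (hwJ i) hi
      have e3 : W i = W j := hinj 1 i j (e2.symm.trans e1)
      rw [← e3]
      have : z ∈ cc J z := cc_mem hzJ
      rw [hi] at this
      exact this
    · intro hz
      have := cc_map hFc hFJ (hwJ j) ⟨z, hz, rfl⟩
      rw [← Function.iterate_succ_apply' F] at this
      exact this
  -- choice of classical points depending only on the component
  have hfin : {b' : K | cl b' = F OnePoint.infty}.Finite := by
    apply Set.Subsingleton.finite
    intro b1 hb1 b2 hb2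
    have e1 : cl b1 = F OnePoint.infty := hb1
    have e2 : cl b2 = F OnePoint.infty := hb2
    exact cl_injective (e1.trans e2.symm)
  have hch : ∀ S : Set (BerkP1 K), ∃ a : K, (∃ j, S = W j) → cl a ∈ S ∧ cl a ≠ F OnePoint.infty := by
    intro S
    by_cases hS : ∃ j, S = W j
    · obtain ⟨j, rfl⟩ := hS
      obtain ⟨a, h1, h2⟩ := cl_dense (hWo j) ⟨_, cc_mem (hwJ j)⟩ _ hfin
      exact ⟨a, fun _ => ⟨h1, h2⟩⟩
    · exact ⟨0, fun h => absurd h hS⟩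
  choose A hA using hch
  have hAm : ∀ j, cl (A (W j)) ∈ W j := fun j => (hA (W j) ⟨j, rfl⟩).1
  have hAi : ∀ j, cl (A (W j)) ≠ F OnePoint.infty := fun j => (hA (W j) ⟨j, rfl⟩).2
  have hnc : ∀ l m, W l ≠ W m → cl (A (W m)) ∉ closure (W l) := fun l m h =>
    notMem_closure_of_disjoint (hWo m) (cc_disjoint h) (hAm m)
  have hAne : ∀ l m, W l ≠ W m → A (W l) ≠ A (W m) := by
    intro l m h h'
    apply hnc l m h
    rw [← h']
    exact subset_closure (hAm l)
  have hnull : ∀ l m, W l ≠ W m → ∃ τ : ℝ, 0 ≤ τ ∧ τ < 1 ∧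
      μ {y | τ * (rad (W l) (A (W l)) (A (W m)) * bkN y (A (W m))) < bkN y (A (W l)) ∧
        bkN y (A (W l)) < rad (W l) (A (W l)) (A (W m)) * bkN y (A (W m))} = 0 := by
    intro l m hlm
    have hk : ∀ k, W (l + k) ≠ W (m + k) := fun k h => hlm (hinj k l m h)
    have := annulus_null hd F hFc μ hinv p hp (fun k => A (W (l + k))) (fun k => A (W (m + k)))
      (fun k => rad (W (l + k)) (A (W (l + k))) (A (W (m + k)))) (fun k => hAne _ _ (hk k))
      (fun k => (rad_spec (hWo _) (hWc _) (hAm _) (hnc _ _ (hk k))).1)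
      (by simp only [hper, add_zero, hWdef]) (by simp only [hper, add_zero, hWdef])
      (by simp only [hper, add_zero, hWdef])
      (fun k => pair_map f F hFc hFext hd (hWo _) (hWo _) (hWo _) (hWo _) (hWc _) (hWc _) (hWc _)
        (hWc _) (cc_disjoint (hk k)) (cc_disjoint (hk (k + 1))) (hpre (l + k)) (hpre (m + k))
        (hAm _) (hAm _) (hAm _) (hAm _) (hAi _) (hAi _))
    simpa only [add_zero] using this
  -- local nullity of a boundary near an exit point
  have hexit : ∀ l m, W l ≠ W m → ∃ O : Set (BerkP1 K), IsOpen O ∧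
      etp (A (W l)) (A (W m)) (rad (W l) (A (W l)) (A (W m))) ∈ O ∧ μ (O ∩ frontier (W l)) = 0 := by
    intro l m hlm
    obtain ⟨τ, h0, h1, h2⟩ := hnull l m hlm
    have hr := (rad_spec (hWo l) (hWc l) (hAm l) (hnc l m hlm)).1
    have hne := hAne l m hlm
    set a := A (W l) with ha
    set b := A (W m) with hb
    set r := rad (W l) a b with hrdef
    refine ⟨{y | τ * (r * bkN y b) < bkN y a}, isOpen_lt (by
      exact continuous_const.mul (continuous_const.mul (bkN_continuous _))) (bkN_continuous _), ?_, ?_⟩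
    · rw [Set.mem_ofPred_eq, eta_ratio a b hr.le]
      have hp := bkN_eta_pos_right hne hr.le
      have : 0 < r * bkN (etp a b r) b := by positivity
      nlinarith
    · refine measure_mono_null ?_ (measure_union_null h2
        (hatom _ (eta_nonclassical hne hr)))
      rintro y ⟨hy1, hy2⟩
      have hy3 : y ∈ closure (W l) := frontier_subset_closure hy2
      rcases (rad_le (hWo l) (hWc l) (hAm l) (hnc l m hlm) hy3).lt_or_eq with h | h
      · exact Or.inl ⟨hy1, h⟩
      · exact Or.inr (rad_closure_eq (hWo l) (hWc l) (hAm l) (hnc l m hlm) hy3 h)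
  have h00 : W 0 ≠ W j0 := fun h => hj0 h.symm
  set c := etp (A (W 0)) (A (W j0)) (rad (W 0) (A (W 0)) (A (W j0))) with hc
  have hcm := rad_mem_closure (hWo 0) (hWc 0) (hAm 0) (hnc 0 j0 h00)
  have hcJ : c ∈ J := by
    by_contra h
    exact hcm.2 (cc_closure hJ hcm.1 h)
  have hO : ∀ l, ∃ O : Set (BerkP1 K), IsOpen O ∧ c ∈ O ∧ μ (O ∩ frontier (W l)) = 0 := by
    intro l
    by_cases hcl : c ∈ frontier (W l)
    · by_cases hl : W l = W 0
      · rw [hl]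
        exact hexit 0 j0 h00
      · obtain ⟨O, o1, o2, o3⟩ := hexit l 0 hl
        refine ⟨O, o1, ?_, o3⟩
        rw [pair_common (hWo l) (hWc l) (hWo 0) (hWc 0) (cc_disjoint hl) (hAm l) (hAm 0)
          (frontier_subset_closure hcl) hcm.1]
        exact o2
    · exact ⟨(frontier (W l))ᶜ, isClosed_frontier.isOpen_compl, hcl, by simp⟩
  choose O o1 o2 o3 using hO
  have hfinal : μ (⋂ l ∈ Finset.range p, O l) = 0 := by
    have hJn : μ Jᶜ = 0 := by rw [hJs]; exact msupport_compl_null μ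
    refine measure_mono_null ?_ (measure_union_null hJn
      ((measure_biUnion_null_iff (Finset.range p).countable_toSet).2 fun l _ => o3 l))
    intro y hy
    by_cases hyJ : y ∈ J
    · right
      rw [hJeq] at hyJ
      simp only [Set.mem_iUnion] at hyJ hy ⊢
      obtain ⟨l, hl, hyl⟩ := hyJ
      exact ⟨l, hl, Set.mem_iInter₂.1 hy l hl, hyl⟩
    · exact Or.inl hyJ
  have hopen : IsOpen (⋂ l ∈ Finset.range p, O l) :=
    isOpen_biInter_finset fun l _ => o1 l
  rw [hJs] at hcJ
  have := hcJ _ hopen (Set.mem_iInter₂.2 fun l _ => o2 l)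
  exact this.ne' hfinal

theorem main_frontier (f : RatFunc K) (hd : 1 < rdeg K f)
    (F : BerkP1 K → BerkP1 K) (hFc : Continuous F)
    (hFext : ∀ w : OnePoint K, F (iota K w) = iota K (evalP1 K f w))
    (μ : Measure (BerkP1 K)) [IsProbabilityMeasure μ] [μ.Regular]
    (hinv : ∀ A : Set (BerkP1 K), MeasurableSet A → μ (F ⁻¹' A) = μ A)
    (herg : ∀ A : Set (BerkP1 K), MeasurableSet A → F ⁻¹' A = A → μ A = 0 ∨ μ A = 1)
    (hatom : ∀ S : BerkP1 K, (∀ a : OnePoint K, iota K a ≠ S) → μ {S} = 0)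
    {J : Set (BerkP1 K)} (hJs : J = msupport K μ) (hFJ : F ⁻¹' J = J)
    {x : BerkP1 K} (hx : x ∈ Jᶜ) {p : ℕ} (hp : 0 < p) (hper : F^[p] '' (cc J x) = cc J x)
    (hWinv : F ⁻¹' (cc J x) ≠ cc J x) : μ (frontier (cc J x)) = 0 := by
  by_contra hne
  have hJ : IsClosed J := by rw [hJs]; exact msupport_closed μ
  have hJeq : J = ⋃ j ∈ Finset.range p, frontier (cc J (F^[j] x)) := by
    subst hJs
    exact support_eq μ hFc hFJ hinv herg hx hp hper hne
  have hperj := cc_periodic hFc hFJ hx hper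
  have hback : ∀ z ∈ Jᶜ, ∀ j, cc J (F z) = cc J (F^[j] x) → ∃ i, cc J z = cc J (F^[i] x) := by
    intro z hz j hj
    by_contra hcon
    push Not at hcon
    obtain ⟨h1, h2⟩ := caseA f F hFc hFext hd hJ hFJ (fun i => F^[i] x)
      (fun i => notMem_iter hFJ hx i) hJeq hz (fun i _ => hcon i)
    rw [hj] at h1 h2
    have h3 : μ (frontier (cc J (F^[j] x))) = 0 := by
      rw [← Set.biUnion_of_singleton (frontier (cc J (F^[j] x)))]
      exact (measure_biUnion_null_iff h1.countable).2 fun y hy => hatom y (h2 y hy)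
    have h4 := cc_frontier_measure_iter hJ hFc hFJ μ hinv hx j
    rw [h3] at h4
    exact hne (le_antisymm h4 bot_le)
  have hj : ∃ j, cc J (F^[j] x) ≠ cc J (F^[0] x) := by
    by_contra hcon
    push Not at hcon
    apply hWinv
    ext z
    constructor
    · intro hz
      have hz' : F z ∈ cc J x := hz
      have hzJ : z ∈ Jᶜ := by
        intro h
        have h1 : z ∈ F ⁻¹' J := by rw [hFJ]; exact h
        exact cc_sub J _ hz' h1
      obtain ⟨i, hi⟩ := hback z hzJ 0 (cc_eq hz').symm
      have : z ∈ cc J z := cc_mem hzJ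
      rw [hi, hcon i] at this
      exact this
    · intro hz
      have h1 := cc_map hFc hFJ hx ⟨z, hz, rfl⟩
      have h2 : cc J (F x) = cc J x := hcon 1
      rw [h2] at h1
      exact h1
  obtain ⟨j, hj⟩ := hj
  exact caseB f F hFc hFext hd μ hinv hatom hJs hJ hFJ hx hp hperj hJeq hback hj

theorem basin_component {J : Set (BerkP1 K)} {F : BerkP1 K → BerkP1 K} (hFc : Continuous F)
    (hFJ : F ⁻¹' J = J) {x y : BerkP1 K} (hx : x ∈ Jᶜ) {n : ℕ} (hy : F^[n] y ∈ cc J x) :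
    y ∈ Jᶜ ∧ cc J (F^[n] y) = cc J x ∧
      connectedComponentIn (⋃ n : ℕ, F^[n] ⁻¹' (cc J x)) y = cc J y := by
  have hJn : ∀ n z, F^[n] z ∈ cc J x → z ∈ Jᶜ := by
    intro n
    induction n with
    | zero => intro z hz; exact cc_sub J _ hz
    | succ n ih =>
      intro z hz hzJ
      rw [Function.iterate_succ_apply] at hz
      have h1 : z ∈ F ⁻¹' J := by rw [hFJ]; exact hzJ
      exact ih _ hz h1
  have hyJ := hJn n y hy
  have he := (cc_eq hy).symm
  refine ⟨hyJ, he, ?_⟩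
  have hsubJ : (⋃ n : ℕ, F^[n] ⁻¹' (cc J x)) ⊆ Jᶜ := by
    intro z hz
    obtain ⟨m, hm⟩ := Set.mem_iUnion.1 hz
    exact hJn m z hm
  have hcc : cc J y ⊆ ⋃ n : ℕ, F^[n] ⁻¹' (cc J x) := by
    intro z hz
    refine Set.mem_iUnion.2 ⟨n, ?_⟩
    have hzJ : z ∈ Jᶜ := cc_sub J _ hz
    have h1 := cc_iter_eq hFc hFJ hyJ hzJ (cc_eq hz) n
    have h2 : F^[n] z ∈ cc J (F^[n] z) := cc_mem (notMem_iter hFJ hzJ n)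
    rw [← h1, he] at h2
    exact h2
  apply Set.Subset.antisymm
  · exact connectedComponentIn_mono y hsubJ
  · exact (cc_pre J y).subset_connectedComponentIn (cc_mem hyJ) hcc

end BerkCaseBMain

/-- If `μ` is an `f`-invariant, ergodic Radon probability measure with totally invariant
support and no atoms at non-classical points (`f` of degree `> 1`, extended continuously to
`P^1_Berk(K)`), and `W` is a connected component of the complement of `supp μ` with
`f^p(W) = W` for some `p ∈ ℕ` and `f⁻¹(W) ≠ W`, then every connected component `U` of
`⋃_{n ≥ 0} f⁻ⁿ(W)` satisfies `μ(∂U) = 0`. -/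
theorem boundary_of_basin_component_null (f : RatFunc K) (hd : 1 < rdeg K f)
    (F : BerkP1 K → BerkP1 K) (hFc : Continuous F)
    (hFext : ∀ w : OnePoint K, F (iota K w) = iota K (evalP1 K f w))
    (μ : Measure (BerkP1 K)) (hμp : IsProbabilityMeasure μ) (hμr : μ.Regular)
    (hinv : ∀ A : Set (BerkP1 K), MeasurableSet A → μ (F ⁻¹' A) = μ A)
    (herg : ∀ A : Set (BerkP1 K), MeasurableSet A → F ⁻¹' A = A → μ A = 0 ∨ μ A = 1)
    (hsupp : F ⁻¹' msupport K μ = msupport K μ)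
    (hatom : ∀ S : BerkP1 K, (∀ a : OnePoint K, iota K a ≠ S) → μ {S} = 0)
    (x : BerkP1 K) (hx : x ∈ (msupport K μ)ᶜ)
    (W : Set (BerkP1 K)) (hW : W = connectedComponentIn ((msupport K μ)ᶜ) x)
    (p : ℕ) (hp : 0 < p) (hWper : F^[p] '' W = W) (hWinv : F ⁻¹' W ≠ W)
    (U : Set (BerkP1 K)) (y : BerkP1 K) (hy : y ∈ ⋃ n : ℕ, F^[n] ⁻¹' W)
    (hU : U = connectedComponentIn (⋃ n : ℕ, F^[n] ⁻¹' W) y) :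
    μ (frontier U) = 0 := by
  haveI := hμp
  haveI := hμr
  obtain ⟨n, hn⟩ := Set.mem_iUnion.1 hy
  have hW' : W = cc (msupport K μ) x := hW
  subst hW'
  obtain ⟨h1, h2, h3⟩ := basin_component hFc hsupp hx hn
  rw [hU, h3]
  have h4 := main_frontier f hd F hFc hFext μ hinv herg hatom rfl hsupp hx hp hWper hWinv
  have h5 := cc_frontier_measure_iter (msupport_closed μ) hFc hsupp μ hinv h1 n
  rw [h2, h4] at h5
  exact le_antisymm h5 bot_le
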